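/- Let q be a prime power, F a finite field with exactly q² elements, and σ : F → F the map x ↦ x^q. For n ≥ 1, the number of conjugacy classes of the special unitary group SU(n,q) satisfies q^{n−1} ≤ k(SU(n,q)) ≤ 8.26 · q^{n−1}. -/

import Mathlib

/-- The special unitary group, as the kernel of the determinant homomorphism on the
unitary group. -/
noncomputable def SU (n : ℕ) (F : Type*) [Field F] [Fintype F] [StarRing F] :
    Subgroup (Matrix.unitaryGroup (Fin n) F) :=
  MonoidHom.ker
    { toFun := fun A => Matrix.det (A : Matrix (Fin n) (Fin n) F)
      map_one' := by simp
      map_mul' := by intro A B; simp }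

/-- For two endomorphisms of a finite group with `range N ≤ ker D` and `range D ≤ ker N`,
exactness at one spot implies exactness at the other one. -/
theorem ker_le_range_of_ker_le_range {G : Type*} [Group G] [Finite G] (N D : G →* G)
    (hND : N.range ≤ D.ker) (h : N.ker ≤ D.range) : D.ker ≤ N.range := by
  have h1 := N.ker.card_eq_card_quotient_mul_card_subgroup
  have h2 := D.ker.card_eq_card_quotient_mul_card_subgroup
  rw [Nat.card_congr (QuotientGroup.quotientKerEquivRange N).toEquiv] at h1
  rw [Nat.card_congr (QuotientGroup.quotientKerEquivRange D).toEquiv] at h2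
  have h3 := Subgroup.card_le_of_le h
  have h4 := Subgroup.card_le_of_le hND
  have h5 : 0 < Nat.card D.range := Nat.card_pos
  have h6 : Nat.card D.ker ≤ Nat.card N.range := by
    by_contra! hlt
    nlinarith [Nat.mul_lt_mul_of_pos_left hlt h5, Nat.mul_le_mul_left (Nat.card N.range) h3]
  exact (Subgroup.eq_of_le_of_card_ge hND h6).ge

section

variable {S : Type*} [CommRing S] (τ : S →+* S)

/-- The norm map `u ↦ u τ(u)` on units. -/
def unitsNorm : Sˣ →* Sˣ where
  toFun u := u * Units.map τ.toMonoidHom u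
  map_one' := by simp
  map_mul' u v := by
    simp only [map_mul]
    exact mul_mul_mul_comm _ _ _ _

/-- The map `u ↦ u / τ(u)` on units. -/
def unitsDiv : Sˣ →* Sˣ where
  toFun u := u * (Units.map τ.toMonoidHom u)⁻¹
  map_one' := by simp
  map_mul' u v := by
    simp only [map_mul, mul_inv]
    exact mul_mul_mul_comm _ _ _ _

variable {τ}

theorem mem_ker_unitsNorm {u : Sˣ} : u ∈ (unitsNorm τ).ker ↔ (u : S) * τ u = 1 := by
  simp [MonoidHom.mem_ker, unitsNorm, Units.ext_iff]

theorem mem_ker_unitsDiv {u : Sˣ} : u ∈ (unitsDiv τ).ker ↔ τ u = u := by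
  simp only [MonoidHom.mem_ker, unitsDiv, MonoidHom.coe_mk, OneHom.coe_mk, mul_inv_eq_one,
    Units.ext_iff]
  exact eq_comm

theorem range_unitsNorm_le (hτ : ∀ x, τ (τ x) = x) : (unitsNorm τ).range ≤ (unitsDiv τ).ker := by
  rintro _ ⟨u, rfl⟩
  rw [mem_ker_unitsDiv]
  simp [unitsNorm, hτ, mul_comm]

theorem range_unitsDiv_le (hτ : ∀ x, τ (τ x) = x) : (unitsDiv τ).range ≤ (unitsNorm τ).ker := by
  rintro _ ⟨u, rfl⟩
  rw [MonoidHom.mem_ker]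
  have : Units.map τ.toMonoidHom (Units.map τ.toMonoidHom u) = u := by ext; simp [hτ]
  change u * (Units.map τ.toMonoidHom u)⁻¹ *
    Units.map τ.toMonoidHom (u * (Units.map τ.toMonoidHom u)⁻¹) = 1
  rw [map_mul, map_inv, this]
  group

/-- Hilbert 90 for a finite field with a nontrivial involution. -/
theorem hilbert90_of_isField (hS : IsField S) (hτ : ∀ x, τ (τ x) = x) {c : S}
    (hc : IsUnit (c - τ c)) : (unitsNorm τ).ker ≤ (unitsDiv τ).range := by
  intro u hu
  rw [mem_ker_unitsNorm] at hu
  have key : ∀ z : S, u * τ z = z → z ≠ 0 → u ∈ (unitsDiv τ).range := by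
    intro z hz h0
    obtain ⟨w, hw⟩ := hS.mul_inv_cancel h0
    refine ⟨⟨z, w, hw, by rw [mul_comm, hw]⟩, ?_⟩
    refine mul_inv_eq_of_eq_mul ?_
    ext
    simpa using hz.symm
  by_cases h1 : (u : S) = -1
  · refine key (c - τ c) ?_ ?_
    · rw [h1, map_sub, hτ]; ring
    · have := hS.nontrivial
      exact hc.ne_zero
  · refine key (1 + u) ?_ ?_
    · rw [map_add, map_one, mul_add, hu]; ring
    · intro h; exact h1 (by linear_combination h)

theorem exists_isIdempotentElem_pow {S : Type*} [Monoid S] [Finite S] (a : S) :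
    ∃ k, 0 < k ∧ IsIdempotentElem (a ^ k) := by
  obtain ⟨i, j, hij, h⟩ := Finite.exists_ne_map_eq_of_infinite (fun n : ℕ => a ^ (n + 1))
  wlog hlt : i < j generalizing i j
  · exact this j i hij.symm h.symm (by omega)
  obtain ⟨d, rfl⟩ := Nat.exists_eq_add_of_lt hlt
  have h1 : ∀ m, a ^ (i + 1 + m) = a ^ (i + 1 + m + (d + 1)) := by
    intro m
    have : a ^ (i + 1) = a ^ (i + 1 + (d + 1)) := by
      rw [show i + 1 + (d + 1) = i + d + 1 + 1 by ring]; exact h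
    rw [pow_add, this, ← pow_add]; congr 1; omega
  have h2 : ∀ t m, a ^ (i + 1 + m) = a ^ (i + 1 + m + t * (d + 1)) := by
    intro t
    induction t with
    | zero => simp
    | succ t ih =>
      intro m
      rw [ih m, add_assoc (i + 1), h1]; congr 1; ring
  refine ⟨(i + 1) * (d + 1), by positivity, ?_⟩
  unfold IsIdempotentElem
  rw [← pow_add]
  have := h2 (i + 1) ((i + 1) * d)
  rw [show i + 1 + (i + 1) * d = (i + 1) * (d + 1) by ring] at this
  exact this.symm

theorem exists_trace_one (hτ : ∀ x, τ (τ x) = x) {c : S} (hc : IsUnit (c - τ c)) :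
    ∃ ω : S, ω + τ ω = 1 := by
  obtain ⟨d, hd⟩ := hc.exists_right_inv
  have h1 : (c - τ c) * τ d = -1 := by
    have := congrArg τ hd
    rw [map_mul, map_sub, hτ, map_one] at this
    linear_combination -this
  have h2 : τ d = -d := by linear_combination d * h1 - τ d * hd
  exact ⟨c * d, by rw [map_mul, h2]; linear_combination hd⟩

end

/-- In a finite commutative ring with an involution `τ` such that `c - τ c` is invertible for
some `c`, each invertible fixed point of `τ` is a norm. -/
theorem exists_mul_map_eq {S : Type*} [CommRing S] [Finite S] (τ : S →+* S)
    (hτ : ∀ x, τ (τ x) = x) (c : S) (hc : IsUnit (c - τ c)) (h : S) (hu : IsUnit h)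
    (hh : τ h = h) : ∃ y, y * τ y = h := by
  induction hn : Nat.card S using Nat.strong_induction_on generalizing S with
  | _ n ih =>
  have red : ∀ b : S, τ b = b → b ≠ 0 → ∃ y x, h - y * τ y = b * x := by
    intro b hb hb0
    let I : Ideal S := Ideal.span {b}
    have hI : I ≤ I.comap τ := by
      rw [Ideal.span_le, Set.singleton_subset_iff]
      simp [hb, I]
    have hfin : Finite (S ⧸ I) := Finite.of_surjective _ Ideal.Quotient.mk_surjective
    have hlt : Nat.card (S ⧸ I) < n := by
      have h1 := I.toAddSubgroup.card_eq_card_quotient_mul_card_addSubgroup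
      have h2 : 1 < Nat.card I.toAddSubgroup := by
        rw [Finite.one_lt_card_iff_nontrivial]
        exact ⟨⟨⟨b, Ideal.mem_span_singleton_self b⟩, 0, by simpa [Subtype.ext_iff] using hb0⟩⟩
      have h3 : 0 < Nat.card (S ⧸ I) := Nat.card_pos
      have h4 : Nat.card S = Nat.card (S ⧸ I) * Nat.card I.toAddSubgroup := h1
      rw [← hn, h4]
      nlinarith
    obtain ⟨y, hy⟩ := ih _ hlt (Ideal.quotientMap I τ hI)
      (by
        intro x
        obtain ⟨x, rfl⟩ := Ideal.Quotient.mk_surjective x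
        simp [hτ])
      (Ideal.Quotient.mk I c) (by simpa using hc.map (Ideal.Quotient.mk I))
      (Ideal.Quotient.mk I h) (hu.map _) (by simp [hh]) rfl
    obtain ⟨y, rfl⟩ := Ideal.Quotient.mk_surjective y
    rw [Ideal.quotientMap_mk, ← map_mul, eq_comm, Ideal.Quotient.eq,
      Ideal.mem_span_singleton'] at hy
    obtain ⟨x, hx⟩ := hy
    exact ⟨y, x, by rw [← hx, mul_comm]⟩
  by_cases hnil : ∃ b : S, τ b = b ∧ b ≠ 0 ∧ b * b = 0
  · obtain ⟨b, hb, hb0, hbb⟩ := hnil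
    obtain ⟨y, x, hyx⟩ := red b hb hb0
    obtain ⟨ω, hω⟩ := exists_trace_one hτ hc
    obtain ⟨h', hh'⟩ := hu.exists_right_inv
    have he : τ (b * x) = b * x := by rw [← hyx]; simp [hh, hτ, mul_comm]
    have hyu : IsUnit y := isUnit_iff_exists_inv.mpr ⟨τ y * (h' + h' * h' * (b * x)), by
      linear_combination (-(h' + h' * h' * (b * x))) * hyx + (1 + h' * b * x) * hh' -
        h' * h' * x * x * hbb⟩
    obtain ⟨z, hz⟩ := hyu.exists_right_inv
    have hz' : τ y * τ z = 1 := by rw [← map_mul, hz, map_one]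
    refine ⟨y + ω * (b * x) * τ z, ?_⟩
    rw [map_add, map_mul, map_mul, he, hτ]
    linear_combination -hyx + b * x * hω + (b * x * τ ω) * hz + (b * x * ω) * hz' +
      (ω * x ^ 2 * τ z * τ ω * z) * hbb
  by_cases hid : ∃ e : S, IsIdempotentElem e ∧ e ≠ 0 ∧ e ≠ 1
  · obtain ⟨e, he, he0, he1⟩ := hid
    unfold IsIdempotentElem at he
    by_cases hid' : ∃ e : S, e * e = e ∧ τ e = e ∧ e ≠ 0 ∧ e ≠ 1
    · obtain ⟨e, he, hte, he0, he1⟩ := hid'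
      obtain ⟨y, x, hy⟩ := red e hte he0
      obtain ⟨y', x', hy'⟩ := red (1 - e) (by simp [hte]) (sub_ne_zero.mpr he1.symm)
      refine ⟨y * (1 - e) + y' * e, ?_⟩
      rw [map_add, map_mul, map_mul, map_sub, map_one, hte]
      linear_combination (y * τ y + y' * τ y' - y * τ y' - y' * τ y + x + x') * he -
        (1 - e) * hy - e * hy'
    · push Not at hid'
      have hte : τ e * τ e = τ e := by rw [← map_mul, he]
      have h0 : e * τ e = 0 := by
        by_contra h0
        have := hid' (e * τ e) (by linear_combination τ e * τ e * he + e * hte)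
          (by rw [map_mul, hτ, mul_comm]) h0
        exact he1 (by linear_combination this - e * this + τ e * he)
      have h1 : e + τ e = 1 := by
        refine hid' (e + τ e) (by linear_combination he + hte + 2 * h0)
          (by rw [map_add, hτ, add_comm]) fun h1 => he0 ?_
        linear_combination e * h1 - he - h0
      refine ⟨h * e + τ e, ?_⟩
      rw [map_add, map_mul, hh, hτ]
      linear_combination (h * h + 1) * h0 + h * he + h * hte + h * h1
  · push Not at hid
    rcases subsingleton_or_nontrivial S with hs | hs
    · exact ⟨1, Subsingleton.elim _ _⟩
    have hred : ∀ a : S, a * a = 0 → a = 0 := by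
      intro a ha
      have hta : τ a * τ a = 0 := by rw [← map_mul, ha, map_zero]
      push Not at hnil
      have h1 : a * τ a = 0 := by
        by_contra h0
        exact hnil (a * τ a) (by rw [map_mul, hτ, mul_comm]) h0
          (by linear_combination τ a * τ a * ha)
      have h2 : ∀ x : S, x * a + τ x * τ a = 0 := by
        intro x
        by_contra h0
        refine hnil (x * a + τ x * τ a) ?_ h0 ?_
        · simp only [map_add, map_mul, hτ]; ring
        · linear_combination x * x * ha + τ x * τ x * hta + 2 * x * τ x * h1
      have h3 := h2 1
      have h4 := h2 c
      rw [map_one] at h3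
      exact (hc.mul_right_eq_zero).mp (by linear_combination h4 - τ c * h3)
    have hred' : ∀ (k : ℕ) (a : S), a ^ k = 0 → a = 0 := by
      intro k a hk
      have : IsReduced S := ⟨fun x hx => by
        have := (isReduced_iff_pow_one_lt (R := S) 2 (by norm_num)).mpr
          (fun x hx => hred x (by rw [← sq, hx]))
        exact this.eq_zero x hx⟩
      exact eq_zero_of_pow_eq_zero hk
    have hF : IsField S := by
      refine ⟨⟨0, 1, zero_ne_one⟩, mul_comm, fun {a} ha => ?_⟩
      obtain ⟨k, hk, hak⟩ := exists_isIdempotentElem_pow a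
      have h0 : a ^ k ≠ 0 := fun h => ha (hred' k a h)
      have h1 := hid _ hak h0
      exact ⟨a ^ (k - 1), by rw [← pow_succ', Nat.sub_add_cancel hk, h1]⟩
    have h1 := ker_le_range_of_ker_le_range _ _ (range_unitsNorm_le hτ)
      (hilbert90_of_isField hF hτ hc)
    obtain ⟨v, hv⟩ := h1 (mem_ker_unitsDiv.mpr (show τ hu.unit = hu.unit from hh))
    exact ⟨v, by simpa [unitsNorm] using congrArg Units.val hv⟩

/-- Hilbert 90 for finite commutative rings with involution. -/
theorem exists_eq_mul_of_mul_map_eq_one {S : Type*} [CommRing S] [Finite S] (τ : S →+* S)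
    (hτ : ∀ x, τ (τ x) = x) (c : S) (hc : IsUnit (c - τ c)) (z : S) (hz : z * τ z = 1) :
    ∃ s, IsUnit s ∧ s = z * τ s := by
  have h := ker_le_range_of_ker_le_range _ _ (range_unitsDiv_le hτ) (fun u hu => by
    rw [mem_ker_unitsDiv] at hu
    obtain ⟨y, hy⟩ := exists_mul_map_eq τ hτ c hc u u.isUnit hu
    have hyu : IsUnit y := isUnit_of_mul_isUnit_left (hy ▸ u.isUnit)
    exact ⟨hyu.unit, by ext; simpa [unitsNorm] using hy⟩)
  let u : Sˣ := ⟨z, τ z, hz, by rw [mul_comm, hz]⟩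
  obtain ⟨s, hs⟩ := h (mem_ker_unitsNorm.mpr (show (u : S) * τ u = 1 from hz))
  refine ⟨s, s.isUnit, ?_⟩
  change s * _⁻¹ = u at hs
  rw [mul_inv_eq_iff_eq_mul] at hs
  simpa using congrArg Units.val hs

open Polynomial in
theorem aeval_mul_of_intertwine {F m k : Type*} [Field F] [Fintype m] [DecidableEq m]
    [Fintype k] [DecidableEq k] {A : Matrix m m F} {M : Matrix k k F} {B : Matrix m k F}
    (h : A * B = B * M) (p : F[X]) : aeval A p * B = B * aeval M p := by
  have hpow : ∀ j : ℕ, A ^ j * B = B * M ^ j := by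
    intro j
    induction j with
    | zero => simp
    | succ j ih => rw [pow_succ', Matrix.mul_assoc, ih, ← Matrix.mul_assoc, h, Matrix.mul_assoc,
        ← pow_succ']
  simp only [aeval_eq_sum_range, Matrix.sum_mul, Matrix.mul_sum, Matrix.smul_mul, Matrix.mul_smul,
    hpow]

open Polynomial in
theorem commute_aeval {F R : Type*} [CommSemiring F] [Semiring R] [Algebra F R] {A X : R}
    (h : Commute A X) (p : F[X]) : Commute (aeval A p) X := by
  induction p using Polynomial.induction_on' with
  | add p q hp hq => rw [map_add]; exact hp.add_left hq
  | monomial k a =>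
    rw [aeval_monomial]
    exact Commute.mul_left (Algebra.commutes a X) (h.pow_left k)

section

variable {F : Type*} [Field F] [StarRing F] {n d : Type*} [Fintype n] [DecidableEq n]
  [Fintype d] [DecidableEq d]

open Matrix in
/-- Each invertible hermitian matrix over a finite field with nontrivial star is of the form
`Y⋆ Y`, where `Y` is in the bicommutant of the given matrix. -/
theorem exists_star_mul_self_eq [Finite F] {c : F} (hc : star c ≠ c) {H : Matrix n n F}
    (hH : star H = H) (hu : IsUnit H) :
    ∃ Y : Matrix n n F, star Y * Y = H ∧ ∀ X, Commute X H → Commute X Y := by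
  have hn : IsStarNormal H := IsSelfAdjoint.isStarNormal hH
  let S := StarAlgebra.adjoin F {H}
  have hHS : H ∈ S := StarAlgebra.self_mem_adjoin_singleton F H
  have hcomm : ∀ y ∈ S, ∀ X, Commute X H → Commute X y ∧ Commute X (star y) := by
    intro y hy X hX
    induction hy using StarAlgebra.adjoin_induction with
    | mem x hx => rw [Set.mem_singleton_iff] at hx; rw [hx, hH]; exact ⟨hX, hX⟩
    | algebraMap r =>
      rw [← algebraMap_star_comm]
      exact ⟨(Algebra.commutes r X).symm, (Algebra.commutes _ X).symm⟩
    | add x y _ _ hx hy =>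
      rw [star_add]; exact ⟨hx.1.add_right hy.1, hx.2.add_right hy.2⟩
    | mul x y _ _ hx hy =>
      rw [star_mul]; exact ⟨hx.1.mul_right hy.1, hy.2.mul_right hx.2⟩
    | star x hx ih => rw [star_star]; exact ih.symm
  have : Finite S := inferInstance
  obtain ⟨y, hy⟩ := exists_mul_map_eq (starRingEnd S) (fun x => star_star x)
    (algebraMap F S c) (by
      have : algebraMap F S c - starRingEnd S (algebraMap F S c) = algebraMap F S (c - star c) := by
        rw [map_sub, starRingEnd_apply, ← algebraMap_star_comm]
      rw [this]
      exact (isUnit_iff_ne_zero.mpr (sub_ne_zero.mpr hc.symm)).map _) ⟨H, hHS⟩ (by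
        obtain ⟨u, rfl⟩ := hu
        obtain ⟨k, hk, hk'⟩ := (isOfFinOrder_of_finite u).exists_pow_eq_one
        refine isUnit_iff_exists_inv.mpr ⟨⟨_, hHS⟩ ^ (k - 1), Subtype.ext ?_⟩
        change (u : Matrix n n F) * (u : Matrix n n F) ^ (k - 1) = 1
        rw [← pow_succ', Nat.sub_add_cancel hk, ← Units.val_pow_eq_pow_val, hk', Units.val_one])
      (Subtype.ext hH)
  refine ⟨y, ?_, fun X hX => (hcomm y y.2 X hX).1⟩
  have := congrArg Subtype.val ((mul_comm _ _).trans hy)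
  exact this

theorem exists_inverse_of_isUnit_star_mul {Y H : Matrix n n F} (h : star Y * Y = H)
    (hu : IsUnit H) : ∃ Z, Y * Z = 1 ∧ Z * Y = 1 := by
  have : IsUnit Y := by
    rw [Matrix.isUnit_iff_isUnit_det] at hu ⊢
    rw [← h, Matrix.det_mul] at hu
    exact isUnit_of_mul_isUnit_right hu
  exact isUnit_iff_exists.mp this

theorem star_mul_self_symm {A : Matrix n n F} (hA : star A * A = 1) : A * star A = 1 :=
  mul_eq_one_comm.mp hA

/-- Unitary matrices that are similar are conjugate under the unitary group. -/
theorem exists_unitary_conj [Finite F] {c : F} (hc : star c ≠ c) {A B P : Matrix n n F}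
    (hA : star A * A = 1) (hB : star B * B = 1) (hP : IsUnit P) (h : P * A = B * P) :
    ∃ U : Matrix n n F, star U * U = 1 ∧ U * A = B * U := by
  have hHu : IsUnit (star P * P) := hP.star.mul hP
  obtain ⟨Y, hY, hYc⟩ := exists_star_mul_self_eq hc (H := star P * P) (by simp) hHu
  have hAH : Commute A (star P * P) := by
    have h1 : star A * (star P * P) * A = star P * P := by
      calc star A * (star P * P) * A = star (P * A) * (P * A) := by
            rw [star_mul]; simp only [mul_assoc]
        _ = star P * ((star B * B) * P) := by rw [h, star_mul]; simp only [mul_assoc]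
        _ = star P * P := by rw [hB, one_mul]
    calc A * (star P * P) = A * (star A * (star P * P) * A) := by rw [h1]
      _ = (A * star A) * (star P * P) * A := by simp only [mul_assoc]
      _ = star P * P * A := by rw [star_mul_self_symm hA, one_mul]
  obtain ⟨Z, hYZ, hZY⟩ := exists_inverse_of_isUnit_star_mul hY hHu
  have hAY : A * Y = Y * A := hYc A hAH
  have hAZ : Z * A = A * Z := by
    calc Z * A = Z * A * (Y * Z) := by rw [hYZ, mul_one]
      _ = Z * (A * Y) * Z := by simp only [mul_assoc]
      _ = (Z * Y) * A * Z := by rw [hAY]; simp only [mul_assoc]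
      _ = A * Z := by rw [hZY, one_mul]
  refine ⟨P * Z, ?_, ?_⟩
  · calc star (P * Z) * (P * Z) = star Z * (star P * P) * Z := by
          rw [star_mul]; simp only [mul_assoc]
      _ = star (Y * Z) * (Y * Z) := by rw [← hY, star_mul]; simp only [mul_assoc]
      _ = 1 := by simp [hYZ]
  · rw [mul_assoc, hAZ, ← mul_assoc, h, mul_assoc]

/-- An isometry of a nondegenerate hermitian form is similar to a unitary matrix. -/
theorem exists_unitary_of_isometry [Finite F] {c : F} (hc : star c ≠ c) {H M : Matrix n n F}
    (hH : star H = H) (hu : IsUnit H) (hM : star M * H * M = H) :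
    ∃ A Y Z : Matrix n n F, star A * A = 1 ∧ Y * Z = 1 ∧ A = Y * M * Z := by
  obtain ⟨Y, hY, -⟩ := exists_star_mul_self_eq hc hH hu
  obtain ⟨Z, hYZ, hZY⟩ := exists_inverse_of_isUnit_star_mul hY hu
  refine ⟨Y * M * Z, Y, Z, ?_, hYZ, rfl⟩
  calc star (Y * M * Z) * (Y * M * Z) = star Z * (star M * (star Y * Y) * M) * Z := by
        simp only [star_mul, mul_assoc]
    _ = star (Y * Z) * (Y * Z) := by rw [hY, hM, ← hY, star_mul]; simp only [mul_assoc]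
    _ = 1 := by simp [hYZ]

theorem commute_star_of_unitary {A P : Matrix n n F} (hA : star A * A = 1) (h : Commute A P) :
    Commute A (star P) := by
  have h1 : star A * star P = star P * star A := by rw [← star_mul, ← star_mul, h.eq]
  calc A * star P = A * (star P * star A) * A := by
        rw [mul_assoc, mul_assoc, hA, mul_one]
    _ = (A * star A) * star P * A := by rw [← h1]; simp only [mul_assoc]
    _ = star P * A := by rw [star_mul_self_symm hA, one_mul]

/-- A normal invertible matrix in the centralizer of a unitary matrix `A` yields a unitary matrix
commuting with `A`. -/
theorem exists_unitary_of_normal {A P : Matrix n n F} (hA : star A * A = 1) (hP : IsUnit P)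
    (hAP : Commute A P) (hn : Commute P (star P)) :
    ∃ U : Matrix n n F, star U * U = 1 ∧ Commute A U ∧ U.det * star P.det = P.det := by
  obtain ⟨Q, hPQ, hQP⟩ := isUnit_iff_exists.mp hP
  have hAP' := commute_star_of_unitary hA hAP
  have h1 : star Q * star P = 1 := by rw [← star_mul, hPQ, star_one]
  have h2 : star P * star Q = 1 := by rw [← star_mul, hQP, star_one]
  refine ⟨P * star Q, ?_, ?_, ?_⟩
  · calc star (P * star Q) * (P * star Q) = Q * (star P * P) * star Q := by
          simp only [star_mul, star_star, mul_assoc]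
      _ = (Q * P) * (star P * star Q) := by rw [← hn.eq]; simp only [mul_assoc]
      _ = 1 := by rw [hQP, h2, one_mul]
  · have : Commute A (star Q) := by
      calc A * star Q = (star Q * star P) * A * star Q := by rw [h1, one_mul]
        _ = star Q * (A * star P) * star Q := by rw [hAP'.eq]; simp only [mul_assoc]
        _ = star Q * A * (star P * star Q) := by simp only [mul_assoc]
        _ = star Q * A := by rw [h2, mul_one]
    exact hAP.mul_right this
  · have : star P.det = (star P).det := by
      rw [Matrix.star_eq_conjTranspose, Matrix.det_conjTranspose]
    rw [this, ← Matrix.det_mul, mul_assoc, h1, mul_one]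

open Polynomial

/-- A split embedding of a module over `F[M]` whose projection is a normal matrix produces
unitary matrices in the centralizer of `A`. -/
theorem exists_unitary_of_split {A : Matrix n n F} {M N : Matrix d d F} {i : Matrix n d F}
    {r : Matrix d n F} (hA : star A * A = 1) (hri : r * i = 1) (hi : A * i = i * M)
    (hr : r * A = M * r) (hn : Commute (i * r) (star (i * r))) (hN : IsUnit N) {p : F[X]}
    (hp : aeval M p = N) :
    ∃ U : Matrix n n F, star U * U = 1 ∧ Commute A U ∧ U.det * star N.det = N.det := by
  have hAE : Commute A (i * r) := by
    change A * (i * r) = i * r * A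
    rw [← Matrix.mul_assoc, hi, Matrix.mul_assoc, Matrix.mul_assoc, hr]
  have hAE' := commute_star_of_unitary hA hAE
  have hAp : ∀ X, Commute A X → Commute (aeval A p) X := fun X hX => commute_aeval hX p
  set P : Matrix n n F := 1 + i * (N - 1) * r with hPdef
  have hP : P = 1 + (aeval A p - 1) * (i * r) := by
    rw [hPdef, ← hp, Matrix.mul_sub, ← aeval_mul_of_intertwine hi, sub_mul, Matrix.sub_mul,
      Matrix.mul_assoc, Matrix.mul_one, one_mul]
  have hdet : P.det = N.det := by
    rw [hPdef, Matrix.mul_assoc, Matrix.det_one_add_mul_comm, Matrix.mul_assoc, hri,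
      Matrix.mul_one, add_sub_cancel]
  have hAp' : ∀ X, Commute A X → Commute (star (aeval A p)) X := by
    intro X hX
    have := congrArg star (hAp _ (commute_star_of_unitary hA hX)).eq
    rw [star_mul, star_mul, star_star] at this
    exact this.symm
  have hself : Commute A (aeval A p) := (hAp A (Commute.refl A)).symm
  have hPn : Commute P (star P) := by
    rw [hP]
    simp only [star_add, star_mul, star_sub, star_one]
    have a1 : Commute (aeval A p - 1) (star (aeval A p) - 1) :=
      ((hAp' _ hself).symm.sub_right (Commute.one_right _)).sub_left (Commute.one_left _)
    have a2 : Commute (aeval A p - 1) (star (i * r)) := (hAp _ hAE').sub_left (Commute.one_left _)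
    have a3 : Commute (star (aeval A p) - 1) (i * r) := (hAp' _ hAE).sub_left (Commute.one_left _)
    refine (Commute.one_left _).add_left ((Commute.one_right _).add_right ?_)
    have := (a2.mul_right a1).mul_left (hn.mul_right a3.symm)
    simpa only [star_mul] using this
  obtain ⟨U, h1, h2, h3⟩ := exists_unitary_of_normal hA (P := P) (by
    rw [Matrix.isUnit_iff_isUnit_det] at hN ⊢; rwa [hdet]) (by
    rw [hP]
    exact (Commute.one_right A).add_right
      ((hself.sub_right (Commute.one_right A)).mul_right hAE)) hPn
  exact ⟨U, h1, h2, by rwa [hdet] at h3⟩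

end

namespace Polynomial

variable {F : Type*} [Field F] [StarRing F]

/-- The monic polynomial whose roots are the inverses of the conjugates of the roots of `f`. -/
noncomputable def conjDual (f : F[X]) : F[X] :=
  C (star (f.coeff 0))⁻¹ * f.reverse.map (starRingEnd F)

/-- Monic polynomials with nonzero constant term that equal their conjugate dual. -/
def IsConjSelfDual (f : F[X]) : Prop :=
  f.Monic ∧ f.coeff 0 ≠ 0 ∧ conjDual f = f

theorem conjDual_mul (f g : F[X]) : conjDual (f * g) = conjDual f * conjDual g := by
  rw [conjDual, conjDual, conjDual, reverse_mul_of_domain, Polynomial.map_mul, mul_coeff_zero,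
    star_mul', mul_inv, C_mul]
  ring

theorem conjDual_one : conjDual (1 : F[X]) = 1 := by
  rw [conjDual, coeff_one_zero, ← C_1, reverse_C, C_1]
  simp

omit [StarRing F] in
theorem natDegree_reverse_eq {f : F[X]} (h0 : f.coeff 0 ≠ 0) :
    f.reverse.natDegree = f.natDegree := by
  rw [reverse_natDegree, natTrailingDegree_eq_zero.mpr (Or.inr h0), Nat.sub_zero]

theorem natDegree_conjDual {f : F[X]} (h0 : f.coeff 0 ≠ 0) :
    (conjDual f).natDegree = f.natDegree := by
  rw [conjDual, natDegree_C_mul (by simpa using h0), natDegree_map, natDegree_reverse_eq h0]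

theorem coeff_conjDual (f : F[X]) (i : ℕ) :
    (conjDual f).coeff i = (star (f.coeff 0))⁻¹ * star (f.coeff (revAt f.natDegree i)) := by
  rw [conjDual, coeff_C_mul, coeff_map, coeff_reverse, starRingEnd_apply]

theorem coeff_zero_conjDual {f : F[X]} (hf : f.Monic) :
    (conjDual f).coeff 0 = (star (f.coeff 0))⁻¹ := by
  rw [coeff_conjDual, revAt_zero, hf.coeff_natDegree, star_one, mul_one]

theorem coeff_zero_conjDual_ne_zero {f : F[X]} (hf : f.Monic) (h0 : f.coeff 0 ≠ 0) :
    (conjDual f).coeff 0 ≠ 0 := by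
  rw [coeff_zero_conjDual hf]
  exact inv_ne_zero (by simpa using h0)

theorem conjDual_monic {f : F[X]} (h0 : f.coeff 0 ≠ 0) : (conjDual f).Monic := by
  rw [Monic, leadingCoeff, natDegree_conjDual h0, coeff_conjDual, revAt_le le_rfl, Nat.sub_self,
    inv_mul_cancel₀ (by simpa using h0)]

theorem conjDual_conjDual {f : F[X]} (hf : f.Monic) (h0 : f.coeff 0 ≠ 0) :
    conjDual (conjDual f) = f := by
  ext i
  rw [coeff_conjDual, natDegree_conjDual h0, coeff_zero_conjDual hf, coeff_conjDual, revAt_invol]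
  have : star (f.coeff 0) ≠ 0 := by simpa using h0
  simp [h0]

theorem conjDual_irreducible {f : F[X]} (hf : f.Monic) (h0 : f.coeff 0 ≠ 0)
    (hi : Irreducible f) : Irreducible (conjDual f) := by
  have hm := conjDual_monic h0
  rw [hm.irreducible_iff_natDegree]
  constructor
  · intro h
    have : (conjDual f).natDegree = 0 := by rw [h, natDegree_one]
    rw [natDegree_conjDual h0] at this
    exact hi.natDegree_pos.ne' this
  · intro a b ha hb hab
    have hne := coeff_zero_conjDual_ne_zero hf h0
    rw [← hab, mul_coeff_zero] at hne
    have ha0 := left_ne_zero_of_mul hne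
    have hb0 := right_ne_zero_of_mul hne
    have h1 : conjDual a * conjDual b = f := by
      rw [← conjDual_mul, hab, conjDual_conjDual hf h0]
    rw [← natDegree_conjDual ha0, ← natDegree_conjDual hb0]
    exact (hf.irreducible_iff_natDegree.mp hi).2 _ _ (conjDual_monic ha0) (conjDual_monic hb0) h1

theorem IsConjSelfDual.map_reverse {f : F[X]} (hf : f.IsConjSelfDual) :
    f.reverse.map (starRingEnd F) = C (star (f.coeff 0)) * f := by
  have h : star (f.coeff 0) ≠ 0 := by simpa using hf.2.1
  calc _ = C (star (f.coeff 0)) * conjDual f := by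
        rw [conjDual, ← mul_assoc, ← C_mul, mul_inv_cancel₀ h, C_1, one_mul]
    _ = _ := by rw [hf.2.2]

theorem IsConjSelfDual.mul {f g : F[X]} (hf : f.IsConjSelfDual) (hg : g.IsConjSelfDual) :
    (f * g).IsConjSelfDual :=
  ⟨hf.1.mul hg.1, by rw [mul_coeff_zero]; exact mul_ne_zero hf.2.1 hg.2.1, by
    rw [conjDual_mul, hf.2.2, hg.2.2]⟩

theorem IsConjSelfDual.coeff_zero_mul_star {f : F[X]} (hf : f.IsConjSelfDual) :
    f.coeff 0 * star (f.coeff 0) = 1 := by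
  have h := coeff_zero_conjDual hf.1
  rw [hf.2.2] at h
  have h' : star (f.coeff 0) ≠ 0 := by simpa using hf.2.1
  nth_rw 1 [h]
  exact inv_mul_cancel₀ h'

/-- Applying a polynomial and its conjugate dual to a unitary matrix. -/
theorem star_aeval_mul_pow {n : Type*} [Fintype n] [DecidableEq n] {A : Matrix n n F}
    (hA : star A * A = 1) (f : F[X]) :
    star (aeval A f) * A ^ f.natDegree = aeval A (f.reverse.map (starRingEnd F)) := by
  have hpow : ∀ k, star (A ^ k) * A ^ k = 1 := by
    intro k
    induction k with
    | zero => simp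
    | succ k ih =>
      rw [pow_succ', star_mul, mul_assoc, ← mul_assoc (star A), hA, one_mul, ih]
  rw [aeval_eq_sum_range' (n := f.natDegree + 1)
    ((natDegree_map_le.trans (reverse_natDegree_le f)).trans_lt (Nat.lt_succ_self _)),
    ← Finset.sum_range_reflect, aeval_eq_sum_range, star_sum, Finset.sum_mul]
  refine Finset.sum_congr rfl fun k hk => ?_
  have hk' : k ≤ f.natDegree := Nat.lt_succ_iff.mp (Finset.mem_range.mp hk)
  have e : f.natDegree + 1 - 1 - k = f.natDegree - k := by omega
  rw [e, coeff_map, coeff_reverse, revAt_le (Nat.sub_le _ _), Nat.sub_sub_self hk',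
    starRingEnd_apply, star_smul, smul_mul_assoc]
  congr 1
  obtain ⟨j, hj⟩ := Nat.exists_eq_add_of_le hk'
  rw [hj, pow_add, ← mul_assoc, hpow, one_mul, Nat.add_sub_cancel_left]

theorem star_aeval_mul_pow' {n : Type*} [Fintype n] [DecidableEq n] {A : Matrix n n F}
    (hA : star A * A = 1) {f : F[X]} (h0 : f.coeff 0 ≠ 0) :
    star (aeval A f) * A ^ f.natDegree = star (f.coeff 0) • aeval A (conjDual f) := by
  have h : star (f.coeff 0) ≠ 0 := by simpa using h0
  rw [star_aeval_mul_pow hA, conjDual, map_mul, aeval_C, ← Algebra.smul_def, smul_smul,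
    mul_inv_cancel₀ h, one_smul]

end Polynomial

section Realization

open Polynomial

variable {F : Type*} [Field F] [StarRing F] {f : F[X]}

/-- The semilinear involution of `F[X]/(f)` inverting the class of `X`. -/
theorem Polynomial.IsConjSelfDual.exists_involution (hf : f.IsConjSelfDual) :
    ∃ τ : AdjoinRoot f →+* AdjoinRoot f, (∀ x, τ (τ x) = x) ∧
      τ (AdjoinRoot.root f) * AdjoinRoot.root f = 1 ∧
      ∀ a : F, τ (algebraMap F _ a) = algebraMap F _ (star a) := by
  obtain ⟨g, hg⟩ : X ∣ f - C (f.coeff 0) := X_dvd_iff.mpr (by simp)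
  have hroot : AdjoinRoot.root f * AdjoinRoot.mk f (-C (f.coeff 0)⁻¹ * g) = 1 := by
    rw [← AdjoinRoot.mk_X, ← map_mul]
    have : X * (-C (f.coeff 0)⁻¹ * g) = 1 - C (f.coeff 0)⁻¹ * f := by
      have h1 : C (f.coeff 0)⁻¹ * C (f.coeff 0) = 1 := by
        rw [← C_mul, inv_mul_cancel₀ hf.2.1, C_1]
      linear_combination (C (f.coeff 0)⁻¹) * hg + h1
    rw [this, map_sub, map_mul, AdjoinRoot.mk_self, mul_zero, sub_zero, map_one]
  generalize AdjoinRoot.mk f (-C (f.coeff 0)⁻¹ * g) = u at hroot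
  let inv : Invertible u := ⟨AdjoinRoot.root f, hroot, by rwa [mul_comm]⟩
  have hev : f.eval₂ ((AdjoinRoot.of f).comp (starRingEnd F)) u = 0 := by
    rw [← eval₂_reverse_mul_pow]
    change eval₂ _ (AdjoinRoot.root f) _ * _ = 0
    rw [← eval₂_map, hf.map_reverse, eval₂_mul, AdjoinRoot.eval₂_root, mul_zero, zero_mul]
  let τ := AdjoinRoot.lift _ u hev
  have hτr : τ (AdjoinRoot.root f) = u := AdjoinRoot.lift_root hev
  have hτa : ∀ a : F, τ (AdjoinRoot.of f a) = AdjoinRoot.of f (star a) := fun a =>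
    AdjoinRoot.lift_of hev
  have hcomp : τ.comp τ = RingHom.id _ := by
    refine AdjoinRoot.ringHom_ext (RingHom.ext fun a => ?_) ?_
    · simp [hτa]
    · have h1 := congrArg τ hroot
      rw [map_mul, hτr, map_one] at h1
      change τ (τ _) = AdjoinRoot.root f
      rw [hτr]
      calc τ u = (AdjoinRoot.root f * u) * τ u := by rw [hroot, one_mul]
        _ = AdjoinRoot.root f := by rw [mul_assoc, h1, mul_one]
  exact ⟨τ, fun x => RingHom.congr_fun hcomp x, by rw [hτr, mul_comm]; exact hroot, hτa⟩

omit [StarRing F] in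
/-- A linear form on `F[X]/(f)` whose kernel contains no nonzero ideal. -/
theorem Polynomial.Monic.exists_nondegenerate_form (hf : f.Monic) :
    ∃ l : AdjoinRoot f →ₗ[F] F, ∀ x, (∀ a, l (x * a) = 0) → x = 0 := by
  refine ⟨lcoeff F (f.natDegree - 1) ∘ₗ AdjoinRoot.modByMonicHom hf, fun x hx => ?_⟩
  by_contra hx0
  set p := AdjoinRoot.modByMonicHom hf x with hp
  have hpx : AdjoinRoot.mk f p = x := AdjoinRoot.mk_leftInverse hf x
  have hp0 : p ≠ 0 := by
    intro h; rw [h, map_zero] at hpx; exact hx0 hpx.symm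
  have hf1 : f ≠ 1 := by
    rintro rfl
    exact hx0 (by rw [← hpx]; exact AdjoinRoot.mk_eq_zero.mpr (one_dvd p))
  have hdeg : p.natDegree < f.natDegree := by
    obtain ⟨g, rfl⟩ := AdjoinRoot.mk_surjective x
    rw [hp, AdjoinRoot.modByMonicHom_mk]
    exact natDegree_modByMonic_lt g hf hf1
  have h := hx (AdjoinRoot.mk f (X ^ (f.natDegree - 1 - p.natDegree)))
  rw [← hpx, ← map_mul, LinearMap.comp_apply, AdjoinRoot.modByMonicHom_mk,
    (modByMonic_eq_self_iff hf).mpr] at h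
  · rw [lcoeff_apply, show f.natDegree - 1 = p.natDegree + (f.natDegree - 1 - p.natDegree) by
      omega, Nat.add_sub_cancel_left, coeff_mul_X_pow] at h
    exact hp0 (leadingCoeff_eq_zero.mp h)
  · apply degree_lt_degree
    rw [natDegree_mul_X_pow _ hp0]
    omega

/-- A nondegenerate linear form on `F[X]/(f)` that is compatible with the involution. -/
theorem Polynomial.IsConjSelfDual.exists_hermitian_form [Finite F] {c : F} (hc : star c ≠ c)
    (hf : f.IsConjSelfDual) {τ : AdjoinRoot f →+* AdjoinRoot f} (hτ : ∀ x, τ (τ x) = x)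
    (hτa : ∀ a : F, τ (algebraMap F _ a) = algebraMap F _ (star a)) :
    ∃ l : AdjoinRoot f →ₗ[F] F, (∀ x, (∀ a, l (x * a) = 0) → x = 0) ∧
      ∀ x, star (l (τ x)) = l x := by
  obtain ⟨l, hl⟩ := hf.1.exists_nondegenerate_form
  have : Module.Finite F (AdjoinRoot f) := hf.1.finite_adjoinRoot
  have : Finite (AdjoinRoot f) := Module.finite_of_finite F
  let m : AdjoinRoot f →ₗ[F] F :=
    { toFun := fun x => star (l (τ x))
      map_add' := fun x y => by simp
      map_smul' := fun a x => by
        rw [Algebra.smul_def, map_mul, hτa, ← Algebra.smul_def, map_smul]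
        simp }
  let Φ : AdjoinRoot f →ₗ[F] (AdjoinRoot f →ₗ[F] F) :=
    (LinearMap.compRight F l) ∘ₗ LinearMap.mul F _
  have hΦ : Function.Injective Φ := (injective_iff_map_eq_zero _).mpr fun x hx =>
    hl x fun a => LinearMap.congr_fun hx a
  have hΦs : Function.Surjective Φ := by
    have := (LinearMap.injective_iff_surjective_of_finrank_eq_finrank (f := Φ)
      (Subspace.dual_finrank_eq (K := F) (V := AdjoinRoot f)).symm).mp hΦ
    exact this
  obtain ⟨z, hz⟩ := hΦs m
  have hz' : ∀ x, l (z * x) = star (l (τ x)) := fun x => LinearMap.congr_fun hz x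
  have hzz : z * τ z = 1 := by
    rw [← sub_eq_zero]
    apply hl
    intro a
    rw [sub_mul, one_mul, map_sub, mul_assoc, hz', map_mul, hτ, hz', hτ, star_star, sub_self]
  obtain ⟨s, hs, hsz⟩ := exists_eq_mul_of_mul_map_eq_one τ hτ (algebraMap F _ c) (by
    rw [hτa, ← map_sub]
    exact (isUnit_iff_ne_zero.mpr (sub_ne_zero.mpr hc.symm)).map _) z hzz
  refine ⟨l ∘ₗ LinearMap.mul F _ s, fun x hx => ?_, fun x => ?_⟩
  · have := hl (s * x) fun a => by rw [mul_assoc]; exact hx a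
    exact hs.mul_right_eq_zero.mp this
  · change star (l (s * τ x)) = l (s * x)
    conv_rhs => rw [hsz, mul_assoc, hz', map_mul, hτ]

/-- Multiplication by the class of `X` on `F[X]/(f)` preserves a nondegenerate hermitian form. -/
theorem Polynomial.IsConjSelfDual.exists_isometry [Finite F] {c : F} (hc : star c ≠ c)
    (hf : f.IsConjSelfDual) {ι : Type*} [Fintype ι] [DecidableEq ι]
    (b : Module.Basis ι F (AdjoinRoot f)) :
    ∃ H : Matrix ι ι F, star H = H ∧ IsUnit H ∧
      star (Algebra.leftMulMatrix b (AdjoinRoot.root f)) * H *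
        Algebra.leftMulMatrix b (AdjoinRoot.root f) = H := by
  obtain ⟨τ, hτ, hτr, hτa⟩ := hf.exists_involution
  obtain ⟨l, hl, hτl⟩ := hf.exists_hermitian_form hc hτ hτa
  have hsum : ∀ v w : ι → F, l (τ (∑ i, v i • b i) * ∑ j, w j • b j) =
      ∑ i, ∑ j, star (v i) * l (τ (b i) * b j) * w j := by
    intro v w
    rw [map_sum, Finset.sum_mul_sum, map_sum]
    simp only [map_sum]
    refine Finset.sum_congr rfl fun i _ => Finset.sum_congr rfl fun j _ => ?_
    rw [Algebra.smul_def, Algebra.smul_def, map_mul τ, hτa, mul_mul_mul_comm,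
      ← map_mul (algebraMap F _), ← Algebra.smul_def, map_smul, smul_eq_mul]
    ring
  refine ⟨Matrix.of fun i j => l (τ (b i) * b j), ?_, ?_, ?_⟩
  · ext i j
    rw [Matrix.star_apply, Matrix.of_apply, Matrix.of_apply, ← hτl (τ (b i) * b j), map_mul τ, hτ,
      mul_comm]
  · rw [← Matrix.mulVec_injective_iff_isUnit]
    intro v v' hv
    rw [← sub_eq_zero, ← Matrix.mulVec_sub] at hv
    rw [← sub_eq_zero]
    generalize v - v' = w at hv
    have hw : ∑ j, w j • b j = 0 := by
      refine hl _ fun a => ?_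
      rw [mul_comm, ← hτ a, ← b.sum_repr (τ a), hsum]
      refine Finset.sum_eq_zero fun i _ => ?_
      simp only [mul_assoc, ← Finset.mul_sum]
      have := congrFun hv i
      rw [Matrix.mulVec, dotProduct] at this
      simp only [Matrix.of_apply] at this
      rw [this, Pi.zero_apply, mul_zero]
    funext i
    exact Fintype.linearIndependent_iff.mp b.linearIndependent w hw i
  · ext i j
    have hb : ∀ k, AdjoinRoot.root f * b k =
        ∑ i, Algebra.leftMulMatrix b (AdjoinRoot.root f) i k • b i := by
      intro k
      rw [← b.sum_repr (AdjoinRoot.root f * b k)]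
      simp only [Algebra.leftMulMatrix_eq_repr_mul, b.sum_repr]
    have h1 := hsum (fun k => Algebra.leftMulMatrix b (AdjoinRoot.root f) k i)
      (fun k => Algebra.leftMulMatrix b (AdjoinRoot.root f) k j)
    rw [← hb, ← hb, map_mul τ, mul_mul_mul_comm, hτr, one_mul] at h1
    rw [Matrix.of_apply, h1, Matrix.mul_apply]
    simp only [Matrix.mul_apply, Finset.sum_mul, Matrix.star_apply, Matrix.of_apply]
    rw [Finset.sum_comm]

omit [StarRing F] in
theorem charpoly_mul_mul_of_mul_eq_one {ι : Type*} [Fintype ι] [DecidableEq ι]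
    {Y Z : Matrix ι ι F} (h : Y * Z = 1) (M : Matrix ι ι F) :
    (Y * M * Z).charpoly = M.charpoly := by
  rw [Matrix.charpoly_mul_comm, ← mul_assoc, mul_eq_one_comm.mp h, one_mul]

/-- Every conjugate self-dual polynomial is the characteristic polynomial of a unitary matrix. -/
theorem Polynomial.IsConjSelfDual.exists_unitary [Finite F] {c : F} (hc : star c ≠ c)
    (hf : f.IsConjSelfDual) {n : ℕ} (hn : f.natDegree = n) :
    ∃ A : Matrix (Fin n) (Fin n) F, star A * A = 1 ∧ A.charpoly = f := by
  subst hn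
  let pb := AdjoinRoot.powerBasis hf.1.ne_zero
  obtain ⟨H, hH, hu, hM⟩ := hf.exists_isometry hc pb.basis
  obtain ⟨A, Y, Z, hA, hYZ, rfl⟩ := exists_unitary_of_isometry hc hH hu hM
  refine ⟨_, hA, ?_⟩
  have h1 := charpoly_leftMulMatrix pb
  rw [AdjoinRoot.minpoly_powerBasis_gen_of_monic hf.1] at h1
  exact (charpoly_mul_mul_of_mul_eq_one hYZ _).trans h1

end Realization

section Splitting

open Matrix Polynomial

variable {F : Type*} [Field F] [StarRing F] {n d : Type*} [Fintype n] [DecidableEq n]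
  [Fintype d] [DecidableEq d]

omit [DecidableEq d] in
theorem star_mul_gram_mul {A : Matrix n n F} {M : Matrix d d F} {B : Matrix n d F}
    (hA : star A * A = 1) (hB : A * B = B * M) : star M * (Bᴴ * B) * M = Bᴴ * B := by
  rw [star_eq_conjTranspose] at *
  calc Mᴴ * (Bᴴ * B) * M = (B * M)ᴴ * (B * M) := by
        rw [conjTranspose_mul]; simp only [Matrix.mul_assoc]
    _ = Bᴴ * (Aᴴ * A) * B := by rw [← hB, conjTranspose_mul]; simp only [Matrix.mul_assoc]
    _ = Bᴴ * B := by rw [hA, Matrix.mul_one]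

/-- If `F[M]`-submodules are either nondegenerate or totally isotropic, and the space spanned by
`M` carries a nondegenerate hermitian form, then a split copy of `M` in the unitary matrix `A` can
be moved to a nondegenerate copy. -/
theorem exists_gram_isUnit [Nonempty d] {c : F} (hc : star c ≠ c) {A : Matrix n n F}
    (hA : star A * A = 1) {M H : Matrix d d F} (hH : star H = H) (hu : IsUnit H)
    (hM : star M * H * M = H) (hsimple : ∀ Z, star M * Z * M = Z → Z ≠ 0 → IsUnit Z)
    {i : Matrix n d F} {r : Matrix d n F} (hri : r * i = 1) (hi : A * i = i * M)
    (hr : r * A = M * r) :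
    ∃ B : Matrix n d F, A * B = B * M ∧ IsUnit (Bᴴ * B) := by
  have hr' : A * (rᴴ * H) = rᴴ * H * M := by
    have h1 := congrArg conjTranspose hr
    rw [conjTranspose_mul, conjTranspose_mul] at h1
    have h2 : rᴴ = A * rᴴ * Mᴴ := by
      rw [Matrix.mul_assoc, ← h1, ← Matrix.mul_assoc, ← star_eq_conjTranspose A,
        star_mul_self_symm hA, Matrix.one_mul]
    calc A * (rᴴ * H) = A * (rᴴ * (star M * H * M)) := by rw [hM]
      _ = A * rᴴ * Mᴴ * H * M := by rw [star_eq_conjTranspose]; simp only [Matrix.mul_assoc]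
      _ = rᴴ * H * M := by rw [← h2]
  by_cases hX : iᴴ * i = 0
  swap
  · exact ⟨i, hi, hsimple _ (star_mul_gram_mul hA hi) hX⟩
  by_cases hY : (rᴴ * H)ᴴ * (rᴴ * H) = 0
  swap
  · exact ⟨_, hr', hsimple _ (star_mul_gram_mul hA hr') hY⟩
  obtain ⟨b, hb⟩ : ∃ b : F, b + star b ≠ 0 := by
    by_contra! h
    have h1 := h 1
    rw [star_one] at h1
    refine hc ?_
    have h2 := h c
    linear_combination h2 - c * h1
  have hB : A * (i + b • (rᴴ * H)) = (i + b • (rᴴ * H)) * M := by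
    rw [Matrix.mul_add, Matrix.add_mul, hi, Matrix.mul_smul, Matrix.smul_mul, hr']
  refine ⟨_, hB, hsimple _ (star_mul_gram_mul hA hB) ?_⟩
  have h1 : iᴴ * (rᴴ * H) = H := by
    rw [← Matrix.mul_assoc, ← conjTranspose_mul, hri, conjTranspose_one, Matrix.one_mul]
  have h2 : (rᴴ * H)ᴴ * i = H := by
    have := congrArg conjTranspose h1
    rwa [conjTranspose_mul, conjTranspose_conjTranspose, ← star_eq_conjTranspose H, hH] at this
  have : (i + b • (rᴴ * H))ᴴ * (i + b • (rᴴ * H)) = (b + star b) • H := by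
    rw [conjTranspose_add, conjTranspose_smul, Matrix.add_mul, Matrix.mul_add, Matrix.mul_add,
      Matrix.mul_smul, Matrix.mul_smul, Matrix.smul_mul, Matrix.smul_mul, hX, hY, h1, h2, smul_zero,
      smul_zero, zero_add, add_zero, add_smul]
  rw [this]
  exact smul_ne_zero hb hu.ne_zero

/-- A nondegenerate copy of `M` in `A` is an orthogonal summand. -/
theorem exists_orthogonal_split {A : Matrix n n F} (hA : star A * A = 1) {M : Matrix d d F}
    (hMu : IsUnit M) {B : Matrix n d F} (hB : A * B = B * M) (hu : IsUnit (Bᴴ * B)) :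
    ∃ r : Matrix d n F, r * B = 1 ∧ r * A = M * r ∧ star (B * r) = B * r := by
  have hG := star_mul_gram_mul hA hB
  have hGH : (Bᴴ * B)ᴴ = Bᴴ * B := by rw [conjTranspose_mul, conjTranspose_conjTranspose]
  have hBA : star M * (Bᴴ * A) = Bᴴ := by
    rw [star_eq_conjTranspose, ← Matrix.mul_assoc, ← conjTranspose_mul, ← hB, conjTranspose_mul,
      Matrix.mul_assoc, ← star_eq_conjTranspose, hA, Matrix.mul_one]
  obtain ⟨W, hGW, hWG⟩ := isUnit_iff_exists.mp hu
  obtain ⟨V, -, hV⟩ := isUnit_iff_exists.mp hMu.star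
  have hWH : Wᴴ = W := by
    have := congrArg conjTranspose hGW
    rw [conjTranspose_mul, hGH, conjTranspose_one] at this
    calc Wᴴ = Wᴴ * (Bᴴ * B * W) := by rw [hGW, Matrix.mul_one]
      _ = W := by rw [← Matrix.mul_assoc, this, Matrix.one_mul]
  have hcancel : Bᴴ * A = Bᴴ * B * (M * (W * Bᴴ)) := by
    calc Bᴴ * A = V * (star M * (Bᴴ * A)) := by rw [← Matrix.mul_assoc V, hV, Matrix.one_mul]
      _ = V * (Bᴴ * B * W * Bᴴ) := by rw [hBA, hGW, Matrix.one_mul]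
      _ = V * (star M * (Bᴴ * B) * M * W * Bᴴ) := by rw [hG]
      _ = V * star M * (Bᴴ * B * (M * (W * Bᴴ))) := by simp only [Matrix.mul_assoc]
      _ = _ := by rw [hV, Matrix.one_mul]
  refine ⟨W * Bᴴ, ?_, ?_, ?_⟩
  · rw [Matrix.mul_assoc, hWG]
  · rw [Matrix.mul_assoc, hcancel, ← Matrix.mul_assoc, hWG, Matrix.one_mul]
  · rw [star_eq_conjTranspose, conjTranspose_mul, conjTranspose_mul, conjTranspose_conjTranspose,
      hWH, Matrix.mul_assoc]

omit [StarRing F] in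
theorem Polynomial.aeval_leftMulMatrix_root {f : F[X]} (b : Module.Basis d F (AdjoinRoot f))
    (p : F[X]) :
    aeval (Algebra.leftMulMatrix b (AdjoinRoot.root f)) p =
      Algebra.leftMulMatrix b (AdjoinRoot.mk f p) := by
  rw [aeval_algHom_apply, AdjoinRoot.aeval_eq]

omit [StarRing F] in
theorem isUnit_of_commute_leftMulMatrix {f : F[X]} (hf : Irreducible f)
    (b : Module.Basis d F (AdjoinRoot f)) {Z : Matrix d d F} (hZ : Z ≠ 0)
    (h : Commute Z (Algebra.leftMulMatrix b (AdjoinRoot.root f))) : IsUnit Z := by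
  have := Fact.mk hf
  have hcomm : ∀ x, Commute Z (Algebra.leftMulMatrix b x) := by
    intro x
    obtain ⟨p, rfl⟩ := AdjoinRoot.mk_surjective x
    rw [← aeval_leftMulMatrix_root]
    exact (commute_aeval h.symm p).symm
  have hlin : ∀ x, Matrix.toLin b b Z x = x * Matrix.toLin b b Z 1 := by
    intro x
    have h1 := congrArg (Matrix.toLin b b) (hcomm x).eq
    rw [Matrix.toLin_mul b b b, Matrix.toLin_mul b b b, Algebra.leftMulMatrix_apply,
      Matrix.toLin_toMatrix] at h1
    simpa using LinearMap.congr_fun h1 1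
  have hZ1 : Z = Algebra.leftMulMatrix b (Matrix.toLin b b Z 1) := by
    apply (Matrix.toLin b b).injective
    ext1 x
    rw [hlin, Algebra.leftMulMatrix_apply, Matrix.toLin_toMatrix]
    simp [mul_comm]
  rw [hZ1] at hZ ⊢
  refine (isUnit_iff_ne_zero.mpr ?_).map _
  intro h0
  rw [h0, map_zero] at hZ
  exact hZ rfl

/-- If `A` is unitary and `F[X]/(f)` is a direct summand of `F ^ n` as a module over `F[A]`, then
it can be chosen so that the projection is normal. -/
theorem exists_normal_split [Finite F] {c : F} (hc : star c ≠ c) {A : Matrix n n F}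
    (hA : star A * A = 1) {f : F[X]} (hf : f.Monic) (h0 : f.coeff 0 ≠ 0) (hirr : Irreducible f)
    (b : Module.Basis d F (AdjoinRoot f)) {M : Matrix d d F}
    (hM : M = Algebra.leftMulMatrix b (AdjoinRoot.root f))
    {i : Matrix n d F} {r : Matrix d n F} (hri : r * i = 1) (hi : A * i = i * M)
    (hr : r * A = M * r) :
    ∃ (i : Matrix n d F) (r : Matrix d n F), r * i = 1 ∧ A * i = i * M ∧ r * A = M * r ∧
      Commute (i * r) (star (i * r)) := by
  have := Fact.mk hirr
  by_cases hdual : conjDual f = f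
  · have hsd : f.IsConjSelfDual := ⟨hf, h0, hdual⟩
    have : Nonempty d := b.index_nonempty
    obtain ⟨H, hH, hu, hMH⟩ := hsd.exists_isometry hc b
    rw [← hM] at hMH
    have hMu : IsUnit M := by
      rw [Matrix.isUnit_iff_isUnit_det] at hu ⊢
      rw [← hMH, Matrix.det_mul] at hu
      exact isUnit_of_mul_isUnit_right hu
    have hsimple : ∀ Z, star M * Z * M = Z → Z ≠ 0 → IsUnit Z := by
      intro Z hZ hZ0
      obtain ⟨W, hHW, hWH⟩ := isUnit_iff_exists.mp hu
      obtain ⟨V, -, hV⟩ := isUnit_iff_exists.mp hMu.star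
      have key : ∀ Z, star M * Z * M = Z → Z * M = V * Z := by
        intro Z hZ
        conv_rhs => rw [← hZ]
        rw [← mul_assoc, ← mul_assoc, hV, one_mul]
      have hWZ : Commute (W * Z) M := by
        calc W * Z * M = W * (V * (H * W)) * Z := by
              rw [hHW, mul_one, mul_assoc, key Z hZ, mul_assoc]
          _ = (W * H) * M * W * Z := by rw [← mul_assoc V, ← key H hMH]; simp only [mul_assoc]
          _ = M * (W * Z) := by rw [hWH, one_mul, mul_assoc]
      rw [hM] at hWZ
      have hZ' : H * (W * Z) = Z := by rw [← mul_assoc, hHW, one_mul]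
      have := isUnit_of_commute_leftMulMatrix hirr b (Z := W * Z)
        (fun h => hZ0 (by rw [← hZ', h, mul_zero])) hWZ
      rw [← hZ']
      exact hu.mul this
    obtain ⟨B, hB, hBu⟩ := exists_gram_isUnit hc hA hH hu hMH hsimple hri hi hr
    obtain ⟨r', h1, h2, h3⟩ := exists_orthogonal_split hA hMu hB hBu
    exact ⟨B, r', h1, hB, h2, by rw [h3]⟩
  · refine ⟨i, r, hri, hi, hr, ?_⟩
    have hfM : aeval M f = 0 := by
      rw [hM, aeval_leftMulMatrix_root, AdjoinRoot.mk_self, map_zero]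
    have hfE : aeval A f * (i * r) = 0 := by
      rw [← Matrix.mul_assoc, aeval_mul_of_intertwine hi, hfM, Matrix.mul_zero, Matrix.zero_mul]
    have hAE : Commute A (i * r) := by
      change A * (i * r) = i * r * A
      rw [← Matrix.mul_assoc, hi, Matrix.mul_assoc, Matrix.mul_assoc, hr]
    have hAE' := commute_star_of_unitary hA hAE
    generalize i * r = E at *
    have hgE : aeval A (conjDual f) * star E = 0 := by
      have h1 : star (f.coeff 0) • (aeval A (conjDual f) * star E) = 0 := by
        rw [← smul_mul_assoc, ← star_aeval_mul_pow' hA h0, mul_assoc, (hAE'.pow_left _).eq,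
          ← mul_assoc, ← star_mul, ← (commute_aeval hAE f).eq, hfE, star_zero, zero_mul]
      exact (smul_eq_zero.mp h1).resolve_left (by simpa using h0)
    have hcop : IsCoprime f (conjDual f) := by
      refine (hirr.isCoprime_or_dvd _).resolve_right fun hdvd => hdual ?_
      exact (eq_of_monic_of_associated hf (conjDual_monic h0)
        (hirr.associated_of_dvd (conjDual_irreducible hf h0 hirr) hdvd)).symm
    obtain ⟨a, b', hab⟩ := hcop
    have h1 : aeval A a * aeval A f + aeval A b' * aeval A (conjDual f) = 1 := by
      rw [← map_mul, ← map_mul, ← map_add, hab, map_one]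
    have h2 : star E = aeval A a * aeval A f * star E := by
      calc star E = (aeval A a * aeval A f + aeval A b' * aeval A (conjDual f)) * star E := by
            rw [h1, one_mul]
        _ = _ := by rw [add_mul, mul_assoc (aeval A b'), hgE, mul_zero, add_zero]
    have h3 : E * star E = 0 := by
      rw [h2, ← mul_assoc, ← ((commute_aeval hAE a).mul_left (commute_aeval hAE f)).eq,
        mul_assoc _ _ E, hfE, mul_zero, zero_mul]
    have h4 : star E * E = 0 := by
      rw [h2, ((commute_aeval hAE' a).mul_left (commute_aeval hAE' f)).eq, mul_assoc, mul_assoc,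
        hfE, mul_zero, mul_zero]
    exact h3.trans h4.symm

/-- If `F[X]/(f)` is a direct summand of `F ^ n` as a module over `F[A]`, then the determinant
maps the unitary centralizer of `A` onto the quotients `t / star t`. -/
theorem exists_unitary_commute_det [Finite F] {c : F} (hc : star c ≠ c) {A : Matrix n n F}
    (hA : star A * A = 1) {f : F[X]} (hf : f.Monic) (h0 : f.coeff 0 ≠ 0) (hirr : Irreducible f)
    (b : Module.Basis d F (AdjoinRoot f))
    {i : Matrix n d F} {r : Matrix d n F} (hri : r * i = 1)
    (hi : A * i = i * Algebra.leftMulMatrix b (AdjoinRoot.root f))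
    (hr : r * A = Algebra.leftMulMatrix b (AdjoinRoot.root f) * r) {z : F} (hz : z * star z = 1) :
    ∃ U : Matrix n n F, star U * U = 1 ∧ Commute A U ∧ U.det = z := by
  have := Fact.mk hirr
  obtain ⟨i', r', h1, h2, h3, h4⟩ := exists_normal_split hc hA hf h0 hirr b rfl hri hi hr
  obtain ⟨t, ht, htz⟩ := exists_eq_mul_of_mul_map_eq_one (starRingEnd F) star_star c
    (isUnit_iff_ne_zero.mpr (sub_ne_zero.mpr hc.symm)) z hz
  have : Module.Finite F (AdjoinRoot f) := hf.finite_adjoinRoot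
  have : Finite (AdjoinRoot f) := Module.finite_of_finite F
  obtain ⟨s, hs⟩ := FiniteField.norm_surjective F (AdjoinRoot f) t
  obtain ⟨p, rfl⟩ := AdjoinRoot.mk_surjective s
  have hdet : (Algebra.leftMulMatrix b (AdjoinRoot.mk f p)).det = t := by
    rw [← hs, Algebra.norm_eq_matrix_det b]
  obtain ⟨U, hU, hAU, hUd⟩ := exists_unitary_of_split hA h1 h2 h3 h4
    (by rw [Matrix.isUnit_iff_isUnit_det, hdet]; exact ht) (aeval_leftMulMatrix_root b p)
  refine ⟨U, hU, hAU, ?_⟩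
  rw [hdet] at hUd
  have ht' : star t ≠ 0 := by simpa using ht.ne_zero
  rw [starRingEnd_apply] at htz
  exact mul_right_cancel₀ ht' (hUd.trans htz)

end Splitting

section Primary

open Polynomial

universe u

variable {F : Type u} [Field F] {n : Type*} [Fintype n] [DecidableEq n]

/-- The `F[X]`-module attached to the matrix `A` is isomorphic to the product of the cyclic modules
`F[X]/(p i ^ e i)`. -/
structure Matrix.HasPrimaryDecomposition (A : Matrix n n F) {ι : Type*} (p : ι → F[X]) (e : ι → ℕ) :
    Prop where
  monic : ∀ i, (p i).Monic
  irreducible : ∀ i, Irreducible (p i)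
  pos : ∀ i, 0 < e i
  exists_equiv : ∃ L : (n → F) ≃ₗ[F] (∀ i, AdjoinRoot (p i ^ e i)),
    ∀ v i, L (A.mulVec v) i = AdjoinRoot.root _ * L v i

theorem Matrix.exists_hasPrimaryDecomposition (A : Matrix n n F) :
    ∃ (ι : Type u) (_ : Fintype ι) (p : ι → F[X]) (e : ι → ℕ), A.HasPrimaryDecomposition p e := by
  classical
  let V := Module.AEval' (Matrix.toLin' A)
  have htors : Module.IsTorsion F[X] V := by
    intro x
    refine ⟨⟨A.charpoly, mem_nonZeroDivisors_of_ne_zero A.charpoly_monic.ne_zero⟩, ?_⟩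
    apply (Module.AEval'.of (Matrix.toLin' A)).symm.injective
    change (Module.AEval'.of (Matrix.toLin' A)).symm (A.charpoly • x) = _
    rw [Module.AEval.of_symm_smul, ← Matrix.charpoly_toLin', LinearMap.aeval_self_charpoly]
    simp
  obtain ⟨ι, _, p, hp, e, ⟨L⟩⟩ := Module.equiv_directSum_of_isTorsion htors
  have hspan : ∀ i, Submodule.span F[X] {p i ^ e i} = Ideal.span {normalize (p i) ^ e i} := by
    intro i
    exact (Ideal.span_singleton_eq_span_singleton.mpr ((normalize_associated (p i)).pow_pow)).symm
  let L₁ : V ≃ₗ[F[X]] ∀ i, F[X] ⧸ Ideal.span {normalize (p i) ^ e i} :=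
    L.trans ((DirectSum.linearEquivFunOnFintype F[X] ι _).trans
      (LinearEquiv.piCongrRight fun i => Submodule.quotEquivOfEq _ _ (hspan i)))
  have hL₁ : ∀ (f : F[X]) (x : V) i, L₁ (f • x) i = Ideal.Quotient.mk _ f * L₁ x i := by
    intro f x i
    rw [map_smul]
    change f • (L₁ x i) = _
    obtain ⟨g, hg⟩ := Ideal.Quotient.mk_surjective (L₁ x i)
    rw [← hg]
    rfl
  let L₂ : (n → F) →ₗ[F] ∀ j : {i // 0 < e i}, AdjoinRoot (normalize (p j) ^ e j) :=
    { toFun := fun v j => L₁ (Module.AEval'.of (Matrix.toLin' A) v) j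
      map_add' := fun v w => by
        funext j
        rw [map_add, map_add]
        rfl
      map_smul' := fun a v => by
        funext j
        rw [map_smul, ← Module.AEval.C_smul, hL₁, RingHom.id_apply]
        generalize L₁ (Module.AEval'.of (Matrix.toLin' A) v) = y
        change _ = a • (show AdjoinRoot (normalize (p j) ^ e j) from y j)
        obtain ⟨g, hg⟩ := Ideal.Quotient.mk_surjective (y j)
        rw [← hg]
        change _ = a • AdjoinRoot.mk _ g
        rw [AdjoinRoot.smul_mk, smul_eq_C_mul, map_mul]
        rfl }
  have hsub : ∀ i, ¬ 0 < e i → Subsingleton (F[X] ⧸ Ideal.span {normalize (p i) ^ e i}) := by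
    intro i hi
    rw [Nat.eq_zero_of_not_pos hi, pow_zero, Ideal.span_singleton_one]
    exact Ideal.Quotient.subsingleton_iff.mpr rfl
  have hbij : Function.Bijective L₂ := by
    constructor
    · rw [injective_iff_map_eq_zero]
      intro v hv
      have : L₁ (Module.AEval'.of (Matrix.toLin' A) v) = 0 := by
        funext i
        by_cases hi : 0 < e i
        · exact congrFun hv ⟨i, hi⟩
        · have := hsub i hi
          exact Subsingleton.elim _ _
      rwa [LinearEquiv.map_eq_zero_iff, LinearEquiv.map_eq_zero_iff] at this
    · intro y
      let y' : ∀ i, F[X] ⧸ Ideal.span {normalize (p i) ^ e i} := fun i =>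
        if hi : 0 < e i then y ⟨i, hi⟩ else 0
      refine ⟨(Module.AEval'.of (Matrix.toLin' A)).symm (L₁.symm y'), ?_⟩
      funext j
      change L₁ (Module.AEval'.of (Matrix.toLin' A) _) j = _
      rw [LinearEquiv.apply_symm_apply, LinearEquiv.apply_symm_apply]
      exact dif_pos j.2
  refine ⟨_, inferInstance, fun j : {i // 0 < e i} => normalize (p j), fun j => e j,
    fun j => monic_normalize (hp _).ne_zero, fun j => ?_, fun j => j.2,
    LinearEquiv.ofBijective L₂ hbij, fun v j => ?_⟩
  · exact (normalize_associated _).irreducible_iff.mpr (hp _)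
  · change L₁ (Module.AEval'.of (Matrix.toLin' A) _) j = _
    rw [← Matrix.toLin'_apply]
    exact (congrArg (fun x => L₁ x j) (Module.AEval.X_smul_of (Matrix.toLin' A) v).symm).trans
      (hL₁ X _ _)

end Primary

section Primary

theorem Matrix.det_blockDiagonal_dep {ι R : Type*} [Fintype ι] [DecidableEq ι] [CommRing R]
    {m : ι → Type*} [∀ i, Fintype (m i)] [∀ i, DecidableEq (m i)]
    (d : ∀ i, Matrix (m i) (m i) R) : (Matrix.blockDiagonal' d).det = ∏ i, (d i).det := by
  let : LinearOrder ι := LinearOrder.lift' (Fintype.equivFin ι) (Fintype.equivFin ι).injective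
  rw [(Matrix.blockTriangular_blockDiagonal' d).det_fintype]
  refine Finset.prod_congr ?_ fun i _ => ?_
  · rfl
  let s : {a : (Σ i, m i) // a.1 = i} ≃ m i := 
    { toFun := fun a => a.2 ▸ a.1.2
      invFun := fun x => ⟨⟨i, x⟩, rfl⟩
      left_inv := by rintro ⟨⟨j, x⟩, rfl⟩; rfl
      right_inv := fun x => rfl }
  rw [← Matrix.det_reindex_self s]
  congr 1
  ext x y
  simp [s, Matrix.toSquareBlock_def]

theorem LinearMap.det_pi_dep {ι R : Type*} [Fintype ι] [CommRing R] {M : ι → Type*}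
    [∀ i, AddCommGroup (M i)] [∀ i, Module R (M i)] [∀ i, Module.Free R (M i)]
    [∀ i, Module.Finite R (M i)] (f : ∀ i, M i →ₗ[R] M i) :
    (LinearMap.pi fun i => (f i).comp (LinearMap.proj i)).det = ∏ i, (f i).det := by
  classical
  let b := fun i => Module.Free.chooseBasis R (M i)
  let B := Pi.basis b
  have h : LinearMap.toMatrix B B (LinearMap.pi fun i => (f i).comp (LinearMap.proj i)) =
      Matrix.blockDiagonal' fun i => LinearMap.toMatrix (b i) (b i) (f i) := by
    ext ⟨i, x⟩ ⟨j, y⟩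
    rw [LinearMap.toMatrix_apply]
    by_cases hij : i = j
    · subst hij
      simp [B, LinearMap.toMatrix_apply, Pi.basis_repr, Pi.basis_apply]
    · rw [Matrix.blockDiagonal'_apply_ne _ _ _ hij]
      simp [B, Pi.basis_repr, Pi.basis_apply, Pi.single_eq_of_ne hij]
  simp_rw [← LinearMap.det_toMatrix B, h, Matrix.det_blockDiagonal_dep, LinearMap.det_toMatrix]

open Polynomial

universe u

variable {F : Type u} [Field F] {n : Type*} [Fintype n] [DecidableEq n]

namespace Matrix.HasPrimaryDecomposition

variable {A B : Matrix n n F} {ι ι' : Type*} {p : ι → F[X]} {e : ι → ℕ} {p' : ι' → F[X]}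
  {e' : ι' → ℕ}

theorem exists_similar (hA : A.HasPrimaryDecomposition p e) (hB : B.HasPrimaryDecomposition p' e')
    (σ : ι ≃ ι') (hp : ∀ i, p' (σ i) = p i) (he : ∀ i, e' (σ i) = e i) :
    ∃ P : Matrix n n F, IsUnit P ∧ P * A = B * P := by
  obtain rfl : (fun i => p' (σ i)) = p := funext hp
  obtain rfl : (fun i => e' (σ i)) = e := funext he
  obtain ⟨LA, hLA⟩ := hA.exists_equiv
  obtain ⟨LB, hLB⟩ := hB.exists_equiv
  let T : (n → F) ≃ₗ[F] (n → F) :=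
    LA.trans ((LinearEquiv.piCongrLeft F (fun j => AdjoinRoot (p' j ^ e' j)) σ).trans LB.symm)
  have hT : ∀ v, T (A.mulVec v) = B.mulVec (T v) := by
    intro v
    apply LB.injective
    funext j
    obtain ⟨i, rfl⟩ := σ.surjective j
    have h1 : ∀ w, LB (T w) (σ i) = LA w i := by
      intro w
      change LB (LB.symm (Equiv.piCongrLeft _ σ (LA w))) (σ i) = _
      rw [LinearEquiv.apply_symm_apply, Equiv.piCongrLeft_apply_apply]
    rw [hLB, h1, h1, hLA]
  refine ⟨LinearMap.toMatrix' T, ?_, ?_⟩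
  · rw [LinearMap.isUnit_toMatrix'_iff]
    exact (LinearMap.isUnit_iff_ker_eq_bot _).mpr T.ker
  · apply Matrix.toLin'.injective
    rw [Matrix.toLin'_mul, Matrix.toLin'_mul, Matrix.toLin'_toMatrix']
    exact LinearMap.ext hT

omit [DecidableEq n] in
theorem sum_natDegree [Fintype ι] (hA : A.HasPrimaryDecomposition p e) :
    ∑ i, e i * (p i).natDegree = Fintype.card n := by
  obtain ⟨L, -⟩ := hA.exists_equiv
  have : ∀ i, Module.Finite F (AdjoinRoot (p i ^ e i)) :=
    fun i => ((hA.monic i).pow (e i)).finite_adjoinRoot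
  have h := L.finrank_eq
  rw [Module.finrank_pi, Module.finrank_pi_fintype] at h
  rw [h]
  refine Finset.sum_congr rfl fun i _ => ?_
  rw [← natDegree_pow]
  exact (finrank_quotient_span_eq_natDegree).symm

theorem det_eq [Fintype ι] (hA : A.HasPrimaryDecomposition p e) :
    A.det = (-1) ^ Fintype.card n * ∏ i, (p i).coeff 0 ^ e i := by
  obtain ⟨L, hL⟩ := hA.exists_equiv
  have : ∀ i, Module.Finite F (AdjoinRoot (p i ^ e i)) :=
    fun i => ((hA.monic i).pow (e i)).finite_adjoinRoot
  have h : (L : (n → F) →ₗ[F] _) ∘ₗ toLin' A ∘ₗ L.symm =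
      LinearMap.pi fun i => (Algebra.lmul F (AdjoinRoot (p i ^ e i)) (AdjoinRoot.root _)) ∘ₗ
        LinearMap.proj i := by
    apply LinearMap.ext
    intro x
    funext i
    simp [hL]
  rw [← LinearMap.det_toLin', ← LinearMap.det_conj _ L, h, LinearMap.det_pi_dep,
    ← hA.sum_natDegree, ← Finset.prod_pow_eq_pow_sum, ← Finset.prod_mul_distrib]
  refine Finset.prod_congr rfl fun i _ => ?_
  have hne : p i ^ e i ≠ 0 := ((hA.monic i).pow (e i)).ne_zero
  have hnorm := Algebra.PowerBasis.norm_gen_eq_coeff_zero_minpoly (AdjoinRoot.powerBasis hne)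
  rw [AdjoinRoot.powerBasis_gen, AdjoinRoot.minpoly_root hne, AdjoinRoot.powerBasis_dim,
    ((hA.monic i).pow (e i)).leadingCoeff, inv_one, map_one, mul_one, natDegree_pow,
    coeff_zero_eq_eval_zero, eval_pow, ← coeff_zero_eq_eval_zero] at hnorm
  exact hnorm

theorem coeff_zero_ne_zero [Fintype ι] (hA : A.HasPrimaryDecomposition p e) (h : A.det ≠ 0)
    (i : ι) : (p i).coeff 0 ≠ 0 := by
  rw [hA.det_eq] at h
  have h1 := Finset.prod_ne_zero_iff.mp (right_ne_zero_of_mul h) i (Finset.mem_univ i)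
  exact fun h2 => h1 (by rw [h2, zero_pow (hA.pos i).ne'])

theorem exists_unitary_commute_det [StarRing F] [Finite F] [Fintype ι] [DecidableEq ι]
    (h : A.HasPrimaryDecomposition p e) {c : F}
    (hc : star c ≠ c) (hA : star A * A = 1) {k : ι} (hk : e k = 1) {z : F} (hz : z * star z = 1) :
    ∃ U : Matrix n n F, star U * U = 1 ∧ Commute A U ∧ U.det = z := by
  have hf : p k ^ e k = p k := by rw [hk, pow_one]
  have h0 : (p k ^ e k).coeff 0 ≠ 0 := by
    rw [hf]
    refine h.coeff_zero_ne_zero (fun h0 => ?_) k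
    have := congrArg Matrix.det hA
    rw [Matrix.det_mul, h0, mul_zero, Matrix.det_one] at this
    exact zero_ne_one this
  obtain ⟨L, hL⟩ := h.exists_equiv
  let b := (AdjoinRoot.powerBasis' ((h.monic k).pow (e k))).basis
  let I : AdjoinRoot (p k ^ e k) →ₗ[F] (n → F) :=
    (L.symm : (∀ i, AdjoinRoot (p i ^ e i)) →ₗ[F] (n → F)) ∘ₗ
      LinearMap.single F (fun i => AdjoinRoot (p i ^ e i)) k
  let R : (n → F) →ₗ[F] AdjoinRoot (p k ^ e k) :=
    LinearMap.proj k ∘ₗ (L : (n → F) →ₗ[F] (∀ i, AdjoinRoot (p i ^ e i)))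
  let M : AdjoinRoot (p k ^ e k) →ₗ[F] AdjoinRoot (p k ^ e k) :=
    Algebra.lmul F _ (AdjoinRoot.root _)
  have hA' : LinearMap.toMatrix (Pi.basisFun F n) (Pi.basisFun F n) (toLin' A) = A :=
    LinearMap.toMatrix'_toLin' A
  have hM : Algebra.leftMulMatrix b (AdjoinRoot.root (p k ^ e k)) = LinearMap.toMatrix b b M := rfl
  refine _root_.exists_unitary_commute_det hc hA ((h.monic k).pow (e k)) h0
    (hf.symm ▸ h.irreducible k) b (i := LinearMap.toMatrix b (Pi.basisFun F n) I)
    (r := LinearMap.toMatrix (Pi.basisFun F n) b R) ?_ ?_ ?_ hz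
  · rw [← LinearMap.toMatrix_comp, ← LinearMap.toMatrix_id b]
    congr 1
    apply LinearMap.ext
    intro x
    simp [R, I]
  · rw [hM, ← LinearMap.toMatrix_comp]
    have hAI := LinearMap.toMatrix_comp b (Pi.basisFun F n) (Pi.basisFun F n) (toLin' A) I
    rw [hA'] at hAI
    rw [← hAI]
    congr 1
    apply LinearMap.ext
    intro x
    apply L.injective
    funext j
    change L (A.mulVec (L.symm (Pi.single k x))) j =
      L (L.symm (Pi.single k (AdjoinRoot.root _ * x))) j
    rw [hL, LinearEquiv.apply_symm_apply, LinearEquiv.apply_symm_apply]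
    by_cases hj : j = k
    · subst hj
      rw [Pi.single_eq_same, Pi.single_eq_same]
    · rw [Pi.single_eq_of_ne hj, Pi.single_eq_of_ne hj, mul_zero]
  · rw [hM, ← LinearMap.toMatrix_comp]
    have hAR := LinearMap.toMatrix_comp (Pi.basisFun F n) (Pi.basisFun F n) b R (toLin' A)
    rw [hA'] at hAR
    rw [← hAR]
    congr 1
    exact LinearMap.ext fun v => hL v k

end Matrix.HasPrimaryDecomposition

end Primary

section Nullity

open Polynomial

universe u

variable {F : Type u} [Field F] {n : Type*} [Fintype n] [DecidableEq n]

theorem Matrix.rank_star [StarRing F] (M : Matrix n n F) : (star M).rank = M.rank := by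
  obtain ⟨V, U, e, hV, hU, h⟩ := M.exists_rank_normal_form
  have h' := congrArg star h
  have hb : star ((fromBlocks 1 0 0 0 : Matrix (Fin M.rank ⊕ Fin (Fintype.card n - M.rank))
      (Fin M.rank ⊕ Fin (Fintype.card n - M.rank)) F).submatrix e e) =
      (fromBlocks 1 0 0 0).submatrix e e := by
    rw [star_eq_conjTranspose, conjTranspose_submatrix, fromBlocks_conjTranspose]
    simp
  rw [hb, ← h, star_mul, star_mul] at h'
  have hd : ∀ X : Matrix n n F, IsUnit X → IsUnit X.det := fun X => (isUnit_iff_isUnit_det X).mp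
  have h2 := congrArg Matrix.rank h'
  rwa [rank_mul_eq_right_of_isUnit_det _ _ (hd _ hU.star),
    rank_mul_eq_left_of_isUnit_det _ _ (hd _ hV.star), rank_mul_eq_left_of_isUnit_det _ _ (hd _ hU),
    rank_mul_eq_right_of_isUnit_det _ _ (hd _ hV)] at h2

theorem AdjoinRoot.finrank_ker_mul_pow {p : F[X]} (hp : p ≠ 0) (e k : ℕ) :
    Module.finrank F (LinearMap.ker (Algebra.lmul F (AdjoinRoot (p ^ e)) (mk _ (p ^ k)))) =
      min e k * p.natDegree := by
  set m := min e k with hm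
  have hme : m ≤ e := min_le_left e k
  let T : (F[X] ⧸ Ideal.span {p ^ m}) →ₗ[F[X]] (F[X] ⧸ Ideal.span {p ^ e}) :=
    Submodule.mapQ _ _ (LinearMap.mulLeft F[X] (p ^ (e - m))) (by
      intro x hx
      rw [Submodule.mem_comap, LinearMap.mulLeft_apply]
      rw [Ideal.mem_span_singleton] at hx ⊢
      calc p ^ e = p ^ (e - m) * p ^ m := by rw [← pow_add, Nat.sub_add_cancel hme]
        _ ∣ _ := mul_dvd_mul_left _ hx)
  have hinj : Function.Injective T := by
    rw [injective_iff_map_eq_zero]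
    intro x hx
    obtain ⟨g, rfl⟩ := Submodule.Quotient.mk_surjective _ x
    rw [Submodule.mapQ_apply, LinearMap.mulLeft_apply, Submodule.Quotient.mk_eq_zero,
      Ideal.mem_span_singleton, ← Nat.sub_add_cancel hme, pow_add, Nat.add_sub_cancel] at hx
    rw [Submodule.Quotient.mk_eq_zero, Ideal.mem_span_singleton]
    exact (mul_dvd_mul_iff_left (pow_ne_zero _ hp)).mp hx
  let T' : AdjoinRoot (p ^ m) →ₗ[F] AdjoinRoot (p ^ e) := T.restrictScalars F
  have hrange : LinearMap.range T' =
      LinearMap.ker (Algebra.lmul F (AdjoinRoot (p ^ e)) (mk _ (p ^ k))) := by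
    ext x
    obtain ⟨g, rfl⟩ := mk_surjective x
    have h1 : mk (p ^ e) g ∈ LinearMap.ker (Algebra.lmul F (AdjoinRoot (p ^ e)) (mk _ (p ^ k))) ↔
        p ^ (e - m) ∣ g := by
      rw [LinearMap.mem_ker]
      change mk _ (p ^ k) * mk _ g = 0 ↔ _
      rw [← map_mul, mk_eq_zero]
      rcases le_total e k with h | h
      · rw [hm, min_eq_left h, Nat.sub_self, pow_zero]
        exact iff_of_true ((pow_dvd_pow p h).mul_right g) (one_dvd g)
      · rw [hm, min_eq_right h]
        nth_rw 1 [← Nat.sub_add_cancel h, pow_add, mul_comm (p ^ (e - k))]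
        exact mul_dvd_mul_iff_left (pow_ne_zero _ hp)
    rw [h1]
    constructor
    · rintro ⟨y, hy⟩
      obtain ⟨f, rfl⟩ := Submodule.Quotient.mk_surjective _ y
      have h2 : mk (p ^ e) (p ^ (e - m) * f) = mk (p ^ e) g := hy
      rw [mk_eq_mk] at h2
      have h3 := (pow_dvd_pow p (Nat.sub_le e m)).trans h2
      exact (dvd_sub_right (dvd_mul_right _ _)).mp h3
    · rintro ⟨f, rfl⟩
      exact ⟨Submodule.Quotient.mk f, rfl⟩
  rw [← hrange, LinearMap.finrank_range_of_inj (f := T') hinj]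
  exact finrank_quotient_span_eq_natDegree.trans (natDegree_pow p m)

theorem AdjoinRoot.finrank_ker_mul_of_isCoprime {f g : F[X]} (h : IsCoprime f g) :
    Module.finrank F (LinearMap.ker (Algebra.lmul F (AdjoinRoot g) (mk _ f))) = 0 := by
  obtain ⟨a, b, hab⟩ := h
  have h1 : mk g a * mk g f = 1 := by
    rw [← map_mul, ← map_one (mk g), mk_eq_mk, ← hab]
    exact ⟨-b, by ring⟩
  have : LinearMap.ker (Algebra.lmul F (AdjoinRoot g) (mk _ f)) = ⊥ := by
    rw [LinearMap.ker_eq_bot']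
    intro x hx
    change mk g f * x = 0 at hx
    rw [← one_mul x, ← h1, mul_assoc, hx, mul_zero]
  rw [this, finrank_bot]

namespace Matrix.HasPrimaryDecomposition

variable {A : Matrix n n F} {ι : Type*} [Fintype ι] {p : ι → F[X]} {e : ι → ℕ}

open Classical in
theorem rank_aeval_pow (hA : A.HasPrimaryDecomposition p e) {φ : F[X]} (hm : φ.Monic)
    (hφ : Irreducible φ) (k : ℕ) :
    (aeval A (φ ^ k)).rank + (∑ i with p i = φ, min (e i) k) * φ.natDegree = Fintype.card n := by
  obtain ⟨L, hL⟩ := hA.exists_equiv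
  have : ∀ i, Module.Finite F (AdjoinRoot (p i ^ e i)) :=
    fun i => ((hA.monic i).pow (e i)).finite_adjoinRoot
  have hL' : ∀ (f : F[X]) v i, L ((aeval A f).mulVec v) i = AdjoinRoot.mk _ f * L v i := by
    intro f v i
    induction f using Polynomial.induction_on generalizing v with
    | C a =>
      rw [aeval_C, Algebra.algebraMap_eq_smul_one, Matrix.smul_mulVec, Matrix.one_mulVec, map_smul,
        Pi.smul_apply, Algebra.smul_def]
      rfl
    | add f g hf hg =>
      rw [map_add, Matrix.add_mulVec, map_add, Pi.add_apply, hf, hg, map_add, add_mul]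
    | monomial k a ih =>
      rw [pow_succ, ← mul_assoc, map_mul, aeval_X, ← Matrix.mulVec_mulVec, ih, hL,
        map_mul _ _ X, AdjoinRoot.mk_X, mul_assoc]
  let K := fun i => LinearMap.ker
    (Algebra.lmul F (AdjoinRoot (p i ^ e i)) (AdjoinRoot.mk _ (φ ^ k)))
  let N : LinearMap.ker (toLin' (aeval A (φ ^ k))) ≃ₗ[F] ∀ i, K i :=
    { toFun := fun v i => ⟨L v.1 i, by
        change AdjoinRoot.mk _ (φ ^ k) * L v.1 i = 0
        have hv : (aeval A (φ ^ k)).mulVec v.1 = 0 := v.2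
        rw [← hL', hv, map_zero]
        rfl⟩
      map_add' := fun v w => by
        funext i
        ext
        simp
      map_smul' := fun a v => by
        funext i
        ext
        simp
      invFun := fun x => ⟨L.symm fun i => (x i).1, by
        rw [LinearMap.mem_ker, toLin'_apply]
        apply L.injective
        funext i
        rw [hL', LinearEquiv.apply_symm_apply, map_zero]
        exact (x i).2⟩
      left_inv := fun v => by simp
      right_inv := fun x => by simp }
  have hker : Module.finrank F (LinearMap.ker (toLin' (aeval A (φ ^ k)))) =
      (∑ i with p i = φ, min (e i) k) * φ.natDegree := by
    rw [N.finrank_eq, Module.finrank_pi_fintype, Finset.sum_mul, Finset.sum_filter]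
    refine Finset.sum_congr rfl fun i _ => ?_
    split_ifs with hi
    · subst hi
      exact AdjoinRoot.finrank_ker_mul_pow hφ.ne_zero _ _
    · refine AdjoinRoot.finrank_ker_mul_of_isCoprime (IsCoprime.pow ?_)
      refine (hφ.coprime_iff_not_dvd).mpr fun hd => hi ?_
      exact (eq_of_monic_of_associated hm (hA.monic i)
        (hφ.associated_of_dvd (hA.irreducible i) hd)).symm
  rw [← hker]
  have := LinearMap.finrank_range_add_finrank_ker (toLin' (aeval A (φ ^ k)))
  rwa [Module.finrank_pi] at this

end Matrix.HasPrimaryDecomposition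

end Nullity

section PrimaryType

open Polynomial

universe u

variable {F : Type u} [Field F] {n : Type*} [Fintype n] [DecidableEq n]

namespace Matrix.HasPrimaryDecomposition

variable {A : Matrix n n F} {ι : Type*} [Fintype ι] {p : ι → F[X]} {e : ι → ℕ}

open Classical in
theorem card_conjDual [StarRing F] (h : A.HasPrimaryDecomposition p e) (hA : star A * A = 1)
    {φ : F[X]} (hm : φ.Monic) (h0 : φ.coeff 0 ≠ 0) (hφ : Irreducible φ) (k : ℕ) :
    Finset.card {i | e i = k ∧ p i = conjDual φ} = Finset.card {i | e i = k ∧ p i = φ} := by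
  have hdual : ∀ k, conjDual (φ ^ k) = conjDual φ ^ k := by
    intro k
    induction k with
    | zero => rw [pow_zero, pow_zero, conjDual_one]
    | succ k ih => rw [pow_succ, pow_succ, conjDual_mul, ih]
  have hdet : IsUnit A.det := by
    refine (isUnit_iff_isUnit_det A).mp ?_
    exact IsUnit.of_mul_eq_one (star A) (star_mul_self_symm hA)
  have hrank : ∀ k, (aeval A (conjDual φ ^ k)).rank = (aeval A (φ ^ k)).rank := by
    intro k
    have hk : (φ ^ k).coeff 0 ≠ 0 := by
      rw [coeff_zero_eq_eval_zero, eval_pow, ← coeff_zero_eq_eval_zero]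
      exact pow_ne_zero k h0
    have h1 := congrArg Matrix.rank (star_aeval_mul_pow' hA hk)
    rw [rank_mul_eq_left_of_isUnit_det _ _ (by rw [det_pow]; exact hdet.pow _), rank_star,
      rank_smul_of_mem_nonZeroDivisors _ (mem_nonZeroDivisors_of_ne_zero (by simpa using hk)),
      hdual] at h1
    exact h1.symm
  have hw : ∀ k, ∑ i with p i = conjDual φ, min (e i) k = ∑ i with p i = φ, min (e i) k := by
    intro k
    have h1 := h.rank_aeval_pow hm hφ k
    have h2 := h.rank_aeval_pow (conjDual_monic h0) (conjDual_irreducible hm h0 hφ) k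
    rw [hrank, natDegree_conjDual h0, ← h1] at h2
    exact Nat.eq_of_mul_eq_mul_right hφ.natDegree_pos (Nat.add_left_cancel h2)
  have hc : ∀ ψ k, Finset.card {i | e i = k + 1 ∧ p i = ψ} + ∑ i with p i = ψ, min (e i) k +
      ∑ i with p i = ψ, min (e i) (k + 2) = 2 * ∑ i with p i = ψ, min (e i) (k + 1) := by
    intro ψ k
    have : Finset.card {i | e i = k + 1 ∧ p i = ψ} =
        ∑ i with p i = ψ, if e i = k + 1 then 1 else 0 := by
      rw [← Finset.card_filter, Finset.filter_filter]
      simp only [and_comm]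
    rw [this, ← Finset.sum_add_distrib, ← Finset.sum_add_distrib, Finset.mul_sum]
    refine Finset.sum_congr rfl fun i _ => ?_
    split_ifs <;> omega
  cases k with
  | zero =>
    rw [Finset.card_eq_zero.mpr, Finset.card_eq_zero.mpr] <;>
    · refine Finset.filter_eq_empty_iff.mpr fun i _ hi => ?_
      exact (h.pos i).ne' hi.1
  | succ k =>
    have h1 := hc φ k
    have h2 := hc (conjDual φ) k
    rw [hw, hw, hw, ← h1] at h2
    omega

end Matrix.HasPrimaryDecomposition

/-- The polynomials `g k` are the products of the irreducible polynomials whose exact `k`-th powers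
occur in a primary decomposition of `A`. -/
def Matrix.HasPrimaryType (A : Matrix n n F) (g : ℕ → F[X]) : Prop :=
  ∃ (ι : Type u) (_ : Fintype ι) (p : ι → F[X]) (e : ι → ℕ), A.HasPrimaryDecomposition p e ∧
    ∀ k, g k = ∏ i with e i = k, p i

namespace Matrix.HasPrimaryType

variable {A B : Matrix n n F} {g : ℕ → F[X]}

theorem exists_similar (hA : A.HasPrimaryType g) (hB : B.HasPrimaryType g) :
    ∃ P : Matrix n n F, IsUnit P ∧ P * A = B * P := by
  classical
  obtain ⟨ι, _, p, e, h, hg⟩ := hA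
  obtain ⟨ι', _, p', e', h', hg'⟩ := hB
  have hfac : ∀ {κ : Type u} [Fintype κ] (r : κ → F[X]) (d : κ → ℕ) (k : ℕ) (φ : F[X]),
      (∀ i, (r i).Monic) → (∀ i, Irreducible (r i)) →
      (UniqueFactorizationMonoid.normalizedFactors (∏ i with d i = k, r i)).count φ =
        Fintype.card {i // (r i, d i) = (φ, k)} := by
    intro κ _ r d k φ hm hi
    have h1 : ∏ i with d i = k, r i = ((Finset.univ.filter (d · = k)).val.map r).prod := rfl
    rw [h1, UniqueFactorizationMonoid.normalizedFactors_prod_eq, Multiset.map_map,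
      show normalize ∘ r = r from funext fun i => (hm i).normalize_eq_self, Multiset.count_map,
      Fintype.card_subtype, ← Finset.filter_val, Finset.card_val, Finset.filter_filter]
    · congr 1
      ext i
      simp [and_comm, eq_comm]
    · intro a ha
      obtain ⟨i, -, rfl⟩ := Multiset.mem_map.mp ha
      exact hi i
  let σ : ι ≃ ι' := Equiv.ofFiberEquiv (f := fun i => (p i, e i)) (g := fun i => (p' i, e' i))
    fun c => Fintype.equivOfCardEq (by
      rw [← hfac p e c.2 c.1 h.monic h.irreducible, ← hfac p' e' c.2 c.1 h'.monic h'.irreducible,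
        ← hg, ← hg'])
  have hσ : ∀ i, (p' (σ i), e' (σ i)) = (p i, e i) := fun i =>
    Equiv.ofFiberEquiv_map (f := fun i => (p i, e i)) (g := fun i => (p' i, e' i)) _ i
  exact h.exists_similar h' σ (fun i => (Prod.ext_iff.mp (hσ i)).1)
    fun i => (Prod.ext_iff.mp (hσ i)).2

omit [DecidableEq n] in
theorem apply_zero (hA : A.HasPrimaryType g) : g 0 = 1 := by
  obtain ⟨ι, _, p, e, h, hg⟩ := hA
  rw [hg, Finset.filter_false_of_mem fun i _ => (h.pos i).ne', Finset.prod_empty]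

theorem exists_unitary_commute_det [StarRing F] [Finite F] (h : A.HasPrimaryType g) {c : F}
    (hc : star c ≠ c) (hA : star A * A = 1) (hg : g 1 ≠ 1) {z : F} (hz : z * star z = 1) :
    ∃ U : Matrix n n F, star U * U = 1 ∧ Commute A U ∧ U.det = z := by
  classical
  obtain ⟨ι, _, p, e, h, hg'⟩ := h
  obtain ⟨i, hi⟩ : ∃ i, e i = 1 := by
    by_contra! hne
    rw [hg', Finset.filter_false_of_mem fun i _ => hne i, Finset.prod_empty] at hg
    exact hg rfl
  exact h.exists_unitary_commute_det hc hA hi hz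

theorem exists_weights (hA : A.HasPrimaryType g) :
    (∀ k, Fintype.card n < k → g k = 1) ∧
    ∑ k ∈ Finset.range (Fintype.card n + 1), k * (g k).natDegree = Fintype.card n ∧
    A.det = (-1) ^ Fintype.card n *
      ∏ k ∈ Finset.range (Fintype.card n + 1), (g k).coeff 0 ^ k := by
  obtain ⟨ι, _, p, e, h, hg⟩ := hA
  have hle : ∀ i, e i ≤ Fintype.card n := by
    intro i
    rw [← h.sum_natDegree]
    calc e i ≤ e i * (p i).natDegree := Nat.le_mul_of_pos_right _ (h.irreducible i).natDegree_pos
      _ ≤ _ := Finset.single_le_sum (f := fun i => e i * (p i).natDegree)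
        (fun _ _ => Nat.zero_le _) (Finset.mem_univ i)
  have hmaps : ∀ i ∈ Finset.univ, e i ∈ Finset.range (Fintype.card n + 1) := fun i _ =>
    Finset.mem_range.mpr (Nat.lt_succ_of_le (hle i))
  refine ⟨fun k hk => ?_, ?_, ?_⟩
  · rw [hg, Finset.filter_false_of_mem fun i _ => ((hle i).trans_lt hk).ne, Finset.prod_empty]
  · nth_rw 2 [← h.sum_natDegree]
    rw [← Finset.sum_fiberwise_of_maps_to hmaps]
    refine Finset.sum_congr rfl fun k _ => ?_
    rw [hg, natDegree_prod_of_monic _ _ fun i _ => h.monic i, Finset.mul_sum]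
    exact Finset.sum_congr rfl fun i hi => by rw [(Finset.mem_filter.mp hi).2]
  · rw [h.det_eq, ← Finset.prod_fiberwise_of_maps_to hmaps]
    congr 1
    refine Finset.prod_congr rfl fun k _ => ?_
    rw [hg, coeff_zero_eq_eval_zero, eval_prod, ← Finset.prod_pow]
    refine Finset.prod_congr rfl fun i hi => ?_
    rw [(Finset.mem_filter.mp hi).2, coeff_zero_eq_eval_zero]

theorem isConjSelfDual [StarRing F] (h : A.HasPrimaryType g) (hA : star A * A = 1) (k : ℕ) :
    (g k).IsConjSelfDual := by
  classical
  obtain ⟨ι, _, p, e, h, hg⟩ := h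
  have hdet : A.det ≠ 0 := by
    intro h0
    have := congrArg Matrix.det hA
    rw [Matrix.det_mul, h0, mul_zero, Matrix.det_one] at this
    exact zero_ne_one this
  have h0 := h.coeff_zero_ne_zero hdet
  have hprod : ∀ s : Finset ι, conjDual (∏ i ∈ s, p i) = ∏ i ∈ s, conjDual (p i) := by
    intro s
    induction s using Finset.induction_on with
    | empty => simp [conjDual_one]
    | insert i s hi ih => rw [Finset.prod_insert hi, Finset.prod_insert hi, conjDual_mul, ih]
  refine ⟨?_, ?_, ?_⟩
  · rw [hg]
    exact monic_prod_of_monic _ _ fun i _ => h.monic i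
  · rw [hg, coeff_zero_eq_eval_zero, eval_prod]
    simp_rw [← coeff_zero_eq_eval_zero]
    exact Finset.prod_ne_zero_iff.mpr fun i _ => h0 i
  · rw [hg, hprod]
    change ((Finset.univ.filter (e · = k)).val.map fun i => conjDual (p i)).prod =
      ((Finset.univ.filter (e · = k)).val.map p).prod
    congr 1
    ext φ
    rw [Multiset.count_map, Multiset.count_map, ← Finset.filter_val, ← Finset.filter_val,
      Finset.card_val, Finset.card_val, Finset.filter_filter, Finset.filter_filter]
    by_cases hφ : φ.Monic ∧ φ.coeff 0 ≠ 0 ∧ Irreducible φ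
    · convert h.card_conjDual hA hφ.1 hφ.2.1 hφ.2.2 k using 2
      · ext i
        simp only [Finset.mem_filter, Finset.mem_univ, true_and]
        refine and_congr_right fun _ => ⟨fun hi => ?_, fun hi => ?_⟩
        · rw [hi, conjDual_conjDual (h.monic i) (h0 i)]
        · rw [hi, conjDual_conjDual hφ.1 hφ.2.1]
      · ext i
        simp [eq_comm]
    · rw [Finset.filter_false_of_mem, Finset.filter_false_of_mem]
      · rintro i - ⟨-, rfl⟩
        exact hφ ⟨h.monic i, h0 i, h.irreducible i⟩
      · rintro i - ⟨-, rfl⟩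
        exact hφ ⟨conjDual_monic (h0 i), coeff_zero_conjDual_ne_zero (h.monic i) (h0 i),
          conjDual_irreducible (h.monic i) (h0 i) (h.irreducible i)⟩

end Matrix.HasPrimaryType

end PrimaryType

section PolynomialOfVector

open Polynomial

variable {F : Type*} [Field F]

/-- The monic polynomial of degree `d + 1` with constant term `c` and the given remaining
coefficients. -/
noncomputable def polynomialOfVector {d : ℕ} (c : F) (v : Fin d → F) : F[X] :=
  ∑ i ∈ Finset.range (d + 2), monomial i
    (if i = 0 then c else if h : i - 1 < d then v ⟨i - 1, h⟩ else 1)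

theorem coeff_polynomialOfVector {d : ℕ} (c : F) (v : Fin d → F) (j : ℕ) :
    (polynomialOfVector c v).coeff j = if j < d + 2 then
      (if j = 0 then c else if h : j - 1 < d then v ⟨j - 1, h⟩ else 1) else 0 := by
  rw [polynomialOfVector, finsetSum_coeff]
  simp only [coeff_monomial]
  rw [Finset.sum_ite_eq' (Finset.range (d + 2)) j]
  simp only [Finset.mem_range]

theorem natDegree_polynomialOfVector {d : ℕ} (c : F) (v : Fin d → F) :
    (polynomialOfVector c v).natDegree = d + 1 := by
  refine natDegree_eq_of_le_of_coeff_ne_zero ?_ ?_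
  · rw [natDegree_le_iff_coeff_eq_zero]
    intro N hN
    rw [coeff_polynomialOfVector, if_neg (by omega)]
  · rw [coeff_polynomialOfVector]
    simp

theorem coeff_zero_polynomialOfVector {d : ℕ} (c : F) (v : Fin d → F) :
    (polynomialOfVector c v).coeff 0 = c := by
  simp [coeff_polynomialOfVector]

theorem coeff_succ_polynomialOfVector {d : ℕ} (c : F) (v : Fin d → F) (i : Fin d) :
    (polynomialOfVector c v).coeff (i + 1) = v i := by
  rw [coeff_polynomialOfVector, if_pos (by omega), if_neg (by omega), dif_pos (by simp)]
  rfl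

theorem polynomialOfVector_monic {d : ℕ} (c : F) (v : Fin d → F) :
    (polynomialOfVector c v).Monic := by
  rw [Monic, leadingCoeff, natDegree_polynomialOfVector, coeff_polynomialOfVector]
  simp

theorem polynomialOfVector_injective {d : ℕ} (c : F) :
    Function.Injective (polynomialOfVector c : (Fin d → F) → F[X]) := by
  intro v w h
  funext i
  rw [← coeff_succ_polynomialOfVector c v, h, coeff_succ_polynomialOfVector]

theorem polynomialOfVector_coeff {d : ℕ} {f : F[X]} (hf : f.Monic) (hd : f.natDegree = d + 1) :
    polynomialOfVector (f.coeff 0) (fun i : Fin d => f.coeff (i + 1)) = f := by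
  ext j
  rw [coeff_polynomialOfVector]
  split_ifs with h1 h2 h3
  · rw [h2]
  · simp only
    congr 1
    omega
  · have : j = f.natDegree := by omega
    rw [this]
    exact hf.symm
  · exact (coeff_eq_zero_of_natDegree_lt (by omega)).symm

end PolynomialOfVector

section Counting

open Polynomial

variable {F : Type*} [Field F] [Fintype F] [StarRing F]

theorem exists_star_ne {q : ℕ} (hq : 1 < q) (hF : Fintype.card F = q ^ 2)
    (hstar : ∀ x : F, star x = x ^ q) : ∃ c : F, star c ≠ c := by
  by_contra! h
  have hne : (X ^ q - X : F[X]) ≠ 0 := FiniteField.X_pow_card_sub_X_ne_zero F hq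
  have h1 := card_le_degree_of_subset_roots (p := (X ^ q - X : F[X])) (Z := Finset.univ) (by
    intro x _
    rw [mem_roots hne, IsRoot.def, eval_sub, eval_pow, eval_X, ← hstar, h, sub_self])
  rw [FiniteField.X_pow_card_sub_X_natDegree_eq F hq, Finset.card_univ, hF] at h1
  nlinarith

open Classical in
theorem card_mul_star_eq_one_le {q : ℕ} (hstar : ∀ x : F, star x = x ^ q) :
    Finset.card {x : F | x * star x = 1} ≤ q + 1 := by
  have h : Finset.filter (fun x : F => x * star x = 1) Finset.univ ⊆
      (nthRoots (q + 1) (1 : F)).toFinset := by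
    intro x hx
    rw [Multiset.mem_toFinset, mem_nthRoots q.succ_pos, pow_succ', ← hstar]
    exact (Finset.mem_filter.mp hx).2
  exact (Finset.card_le_card h).trans ((Multiset.toFinset_card_le _).trans (card_nthRoots _ _))

/-- The coefficient vectors, without the leading and the constant one, of the polynomials of degree
`d + 1` with constant term `c` that equal their conjugate dual. -/
noncomputable def selfDualVectors (d : ℕ) (c : F) : Finset (Fin d → F) :=
  letI := Classical.decPred fun v : Fin d → F => ∀ i, v i = c * star (v i.rev)
  Finset.univ.filter fun v : Fin d → F => ∀ i, v i = c * star (v i.rev)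

theorem mem_selfDualVectors {d : ℕ} {c : F} {v : Fin d → F} :
    v ∈ selfDualVectors d c ↔ ∀ i, v i = c * star (v i.rev) := by
  simp [selfDualVectors]

theorem card_selfDualVectors {q : ℕ} (hq : 1 < q) (hF : Fintype.card F = q ^ 2)
    (hstar : ∀ x : F, star x = x ^ q) (d : ℕ) {c : F} (hc : c * star c = 1) :
    (selfDualVectors d c).card = q ^ d := by
  obtain ⟨α, hα⟩ := exists_star_ne hq hF hstar
  have hα' : α - star α ≠ 0 := sub_ne_zero.mpr hα.symm
  have hbij : Function.Bijective fun x : selfDualVectors d c × selfDualVectors d c =>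
      fun i => x.1.1 i + α * x.2.1 i := by
    constructor
    · rintro ⟨⟨v, hv⟩, ⟨w, hw⟩⟩ ⟨⟨v', hv'⟩, ⟨w', hw'⟩⟩ h
      rw [mem_selfDualVectors] at hv hw hv' hw'
      have h1 : ∀ i, v i + α * w i = v' i + α * w' i := fun i => congrFun h i
      have h2 : ∀ i, v i + star α * w i = v' i + star α * w' i := by
        intro i
        have h3 := congrArg (fun x => c * star x) (h1 i.rev)
        simp only [star_add, star_mul', mul_add, mul_left_comm c (star α)] at h3
        rwa [← hv, ← hw, ← hv', ← hw'] at h3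
      have h3 : w = w' := by
        funext i
        refine mul_left_cancel₀ hα' ?_
        linear_combination h1 i - h2 i
      subst h3
      have h4 : v = v' := funext fun i => add_right_cancel (h1 i)
      subst h4
      rfl
    · intro x
      have hcs : ∀ y : F, c * star (c * star y) = y := fun y => by
        rw [star_mul', star_star, ← mul_assoc, hc, one_mul]
      have hs : star ((α - star α)⁻¹) = -(α - star α)⁻¹ := by
        rw [star_inv₀, star_sub, star_star, ← neg_sub, inv_neg]
      let w : Fin d → F := fun i => (α - star α)⁻¹ * (x i - c * star (x i.rev))
      have hw : w ∈ selfDualVectors d c := by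
        rw [mem_selfDualVectors]
        intro i
        simp only [w, star_mul', hs, star_sub, Fin.rev_rev, star_star]
        linear_combination (α - star α)⁻¹ * x i * (-hc)
      have hxw : ∀ i, c * star (x i.rev) = x i - (α - star α) * w i := by
        intro i
        simp only [w]
        rw [mul_inv_cancel_left₀ hα']
        ring
      refine ⟨⟨⟨fun i => x i - α * w i, ?_⟩, ⟨w, hw⟩⟩, ?_⟩
      · rw [mem_selfDualVectors] at hw ⊢
        intro i
        rw [star_sub, star_mul', mul_sub, hxw]
        linear_combination (-star α) * hw i
      · funext i
        exact sub_add_cancel _ _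
  have h1 := Fintype.card_of_bijective hbij
  rw [Fintype.card_prod, Fintype.card_coe, Fintype.card_fun, Fintype.card_fin, hF, ← sq, ← pow_mul,
    mul_comm, pow_mul] at h1
  exact Nat.pow_left_injective two_ne_zero h1

theorem polynomialOfVector_isConjSelfDual {d : ℕ} {c : F} (hc : c * star c = 1) {v : Fin d → F}
    (hv : v ∈ selfDualVectors d c) : (polynomialOfVector c v).IsConjSelfDual := by
  rw [mem_selfDualVectors] at hv
  refine ⟨polynomialOfVector_monic c v, ?_, ?_⟩
  · rw [coeff_zero_polynomialOfVector]
    exact left_ne_zero_of_mul_eq_one hc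
  · ext j
    have hc' : (star c)⁻¹ = c := inv_eq_of_mul_eq_one_left hc
    have hlead : (polynomialOfVector c v).coeff (d + 1) = 1 := by
      rw [← natDegree_polynomialOfVector c v]
      exact polynomialOfVector_monic c v
    rw [coeff_conjDual, coeff_zero_polynomialOfVector, natDegree_polynomialOfVector, hc']
    rcases Nat.lt_or_ge (d + 1) j with h | h
    · rw [revAt_eq_self_of_lt h, coeff_eq_zero_of_natDegree_lt, star_zero, mul_zero]
      rwa [natDegree_polynomialOfVector]
    · rw [revAt_le h]
      rcases Nat.eq_zero_or_pos j with rfl | h0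
      · rw [Nat.sub_zero, hlead, coeff_zero_polynomialOfVector, star_one, mul_one]
      · rcases Nat.eq_or_lt_of_le h with rfl | h2
        · rw [Nat.sub_self, hlead, coeff_zero_polynomialOfVector, hc]
        · have h3 := coeff_succ_polynomialOfVector c v ⟨j - 1, by omega⟩
          have h4 := coeff_succ_polynomialOfVector c v (Fin.rev ⟨j - 1, by omega⟩)
          rw [Fin.val_rev] at h4
          have h5 : d + 1 - j = d - (j - 1 + 1) + 1 := by omega
          have h6 : j = j - 1 + 1 := by omega
          rw [h5, h4, ← hv]
          rw [← h3]
          exact congrArg _ h6.symm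

open Classical in
/-- The polynomials of degree `d + 1` with constant term `c` that equal their conjugate dual. -/
noncomputable def selfDualPolynomials (d : ℕ) (c : F) : Finset F[X] :=
  if c * star c = 1 then (selfDualVectors d c).image (polynomialOfVector c) else ∅

theorem card_selfDualPolynomials_le {q : ℕ} (hq : 1 < q) (hF : Fintype.card F = q ^ 2)
    (hstar : ∀ x : F, star x = x ^ q) (d : ℕ) (c : F) :
    (selfDualPolynomials d c).card ≤ q ^ d := by
  classical
  rw [selfDualPolynomials]
  split_ifs with hc
  · exact Finset.card_image_le.trans (card_selfDualVectors hq hF hstar d hc).le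
  · exact Nat.zero_le _

theorem mem_selfDualPolynomials {f : F[X]} (hf : f.IsConjSelfDual) {d : ℕ}
    (hd : f.natDegree = d + 1) : f ∈ selfDualPolynomials d (f.coeff 0) := by
  classical
  have h0 := hf.coeff_zero_mul_star
  rw [selfDualPolynomials, if_pos h0, Finset.mem_image]
  refine ⟨_, ?_, polynomialOfVector_coeff hf.1 hd⟩
  rw [mem_selfDualVectors]
  intro i
  have hi := i.2
  conv_lhs => rw [← hf.2.2]
  rw [coeff_conjDual, hd, revAt_le (by omega), inv_eq_of_mul_eq_one_left h0, Fin.val_rev]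
  congr 3
  omega

open Classical in
/-- The polynomials of degree `d` that equal their conjugate dual. -/
noncomputable def selfDualPolynomialsOfDegree (F : Type*) [Field F] [Fintype F] [StarRing F] :
    ℕ → Finset F[X]
  | 0 => {1}
  | d + 1 => (Finset.univ.filter fun c : F => c * star c = 1).biUnion (selfDualPolynomials d)

theorem mem_selfDualPolynomialsOfDegree {f : F[X]} (hf : f.IsConjSelfDual) :
    f ∈ selfDualPolynomialsOfDegree F f.natDegree := by
  classical
  rcases h : f.natDegree with _ | d
  · rw [selfDualPolynomialsOfDegree, Finset.mem_singleton]
    exact hf.1.natDegree_eq_zero.mp h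
  · rw [selfDualPolynomialsOfDegree, Finset.mem_biUnion]
    exact ⟨f.coeff 0, by simpa using hf.coeff_zero_mul_star, mem_selfDualPolynomials hf h⟩

theorem card_selfDualPolynomialsOfDegree_le {q : ℕ} (hq : 1 < q) (hF : Fintype.card F = q ^ 2)
    (hstar : ∀ x : F, star x = x ^ q) (d : ℕ) :
    (selfDualPolynomialsOfDegree F (d + 1)).card ≤ (q + 1) * q ^ d := by
  classical
  rw [selfDualPolynomialsOfDegree]
  refine (Finset.card_biUnion_le_card_mul _ _ (q ^ d) fun c _ =>
    card_selfDualPolynomials_le hq hF hstar d c).trans (Nat.mul_le_mul_right _ ?_)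
  convert card_mul_star_eq_one_le hstar

end Counting

section ConjClassesSU

open Polynomial

theorem Matrix.exists_hasPrimaryType {F : Type*} [Field F] {n : Type*} [Fintype n] [DecidableEq n]
    (A : Matrix n n F) : ∃ g, A.HasPrimaryType g := by
  classical
  obtain ⟨ι, hι, p, e, h⟩ := A.exists_hasPrimaryDecomposition
  exact ⟨fun k => ∏ i with e i = k, p i, ι, hι, p, e, h, fun _ => rfl⟩

variable {F : Type*} [Field F] [Fintype F] [StarRing F] {n : ℕ}

namespace SU

theorem star_mul_self (A : SU n F) : star (A : Matrix (Fin n) (Fin n) F) * A = 1 :=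
  Matrix.mem_unitaryGroup_iff'.mp A.1.2

theorem det_eq_one (A : SU n F) : Matrix.det (A : Matrix (Fin n) (Fin n) F) = 1 :=
  A.2

theorem exists_coe_eq {A : Matrix (Fin n) (Fin n) F} (hA : star A * A = 1) (hdet : A.det = 1) :
    ∃ B : SU n F, (B : Matrix (Fin n) (Fin n) F) = A :=
  ⟨⟨⟨A, Matrix.mem_unitaryGroup_iff'.mpr hA⟩, hdet⟩, rfl⟩

theorem isConj_iff {A B : SU n F} : IsConj A B ↔ ∃ U : Matrix (Fin n) (Fin n) F,
    star U * U = 1 ∧ U.det = 1 ∧ U * A = B * U := by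
  constructor
  · rintro ⟨u, hu⟩
    exact ⟨(u : SU n F), star_mul_self _, det_eq_one _,
      congrArg (fun x : SU n F => (x : Matrix (Fin n) (Fin n) F)) hu⟩
  · rintro ⟨U, h1, h2, h3⟩
    obtain ⟨u, rfl⟩ := exists_coe_eq h1 h2
    exact ⟨toUnits u, Subtype.ext (Subtype.ext h3)⟩

theorem charpoly_eq_of_isConj {A B : SU n F} (h : IsConj A B) :
    Matrix.charpoly (A : Matrix (Fin n) (Fin n) F) =
      Matrix.charpoly (B : Matrix (Fin n) (Fin n) F) := by
  obtain ⟨U, h1, -, h2⟩ := isConj_iff.mp h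
  have h3 : (A : Matrix (Fin n) (Fin n) F) = star U * B * U := by
    rw [mul_assoc, ← h2, ← mul_assoc, h1, one_mul]
  rw [h3, charpoly_mul_mul_of_mul_eq_one h1]

/-- Every self-dual polynomial with the right constant term is the characteristic polynomial of a
special unitary matrix. -/
theorem pow_le_card_conjClasses {q : ℕ} (hq : 1 < q) (hF : Fintype.card F = q ^ 2)
    (hstar : ∀ x : F, star x = x ^ q) (d : ℕ) :
    q ^ d ≤ Nat.card (ConjClasses (SU (d + 1) F)) := by
  obtain ⟨c, hc⟩ := exists_star_ne hq hF hstar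
  have h1 : ((-1) ^ (d + 1) : F) * star ((-1) ^ (d + 1) : F) = 1 := by
    rw [star_pow, star_neg, star_one, ← mul_pow, neg_one_mul, neg_neg, one_pow]
  have h2 : ∀ v : selfDualVectors d ((-1) ^ (d + 1) : F), ∃ A : SU (d + 1) F,
      Matrix.charpoly (A : Matrix (Fin (d + 1)) (Fin (d + 1)) F) =
        polynomialOfVector ((-1) ^ (d + 1)) v.1 := by
    intro v
    obtain ⟨A, hA, hA'⟩ := (polynomialOfVector_isConjSelfDual h1 v.2).exists_unitary hc
      (natDegree_polynomialOfVector _ _)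
    have hdet : A.det = 1 := by
      rw [Matrix.det_eq_sign_charpoly_coeff, hA', coeff_zero_polynomialOfVector, Fintype.card_fin,
        ← mul_pow, neg_one_mul, neg_neg, one_pow]
    obtain ⟨B, rfl⟩ := exists_coe_eq hA hdet
    exact ⟨B, hA'⟩
  choose A hA using h2
  rw [← card_selfDualVectors hq hF hstar d h1, ← Fintype.card_coe, ← Nat.card_eq_fintype_card]
  refine Nat.card_le_card_of_injective (fun v => ConjClasses.mk (A v)) fun v w h => ?_
  have h3 := charpoly_eq_of_isConj (ConjClasses.mk_eq_mk_iff_isConj.mp h)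
  rw [hA, hA] at h3
  exact Subtype.ext (polynomialOfVector_injective _ h3)

theorem card_conjClasses_le {q : ℕ} (hq : 1 < q) (hF : Fintype.card F = q ^ 2)
    (hstar : ∀ x : F, star x = x ^ q) (S T : Finset (ℕ → F[X]))
    (hS : ∀ (A : SU n F) (g : ℕ → F[X]),
      Matrix.HasPrimaryType (A : Matrix (Fin n) (Fin n) F) g → g 1 ≠ 1 → g ∈ S)
    (hT : ∀ (A : SU n F) (g : ℕ → F[X]),
      Matrix.HasPrimaryType (A : Matrix (Fin n) (Fin n) F) g → g 1 = 1 → g ∈ T) :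
    Nat.card (ConjClasses (SU n F)) ≤ S.card + T.card * (q + 1) := by
  classical
  obtain ⟨c, hc⟩ := exists_star_ne hq hF hstar
  choose g hg using fun C : ConjClasses (SU n F) =>
    Matrix.exists_hasPrimaryType (C.out : Matrix (Fin n) (Fin n) F)
  have h1 : ∀ f : ℕ → F[X], ∃ R : Matrix (Fin n) (Fin n) F, ∀ C : ConjClasses (SU n F), g C = f →
      ∃ U : Matrix (Fin n) (Fin n) F, star U * U = 1 ∧ U * R = C.out * U := by
    intro f
    by_cases h : ∃ C, g C = f
    · obtain ⟨D, rfl⟩ := h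
      refine ⟨D.out, fun C hC => ?_⟩
      obtain ⟨P, hP, hP'⟩ := (hg D).exists_similar (hC ▸ hg C)
      exact exists_unitary_conj hc (star_mul_self _) (star_mul_self _) hP hP'
    · exact ⟨1, fun C hC => (h ⟨C, hC⟩).elim⟩
  choose R hR using h1
  choose U hU hUR using fun C => hR (g C) C rfl
  have hdetU : ∀ C, (U C).det * star (U C).det = 1 := fun C => by
    have := congrArg Matrix.det (hU C)
    rwa [Matrix.det_mul, Matrix.star_eq_conjTranspose, Matrix.det_conjTranspose, Matrix.det_one,
      mul_comm] at this
  let φ : ConjClasses (SU n F) → (ℕ → F[X]) × F := fun C =>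
    (g C, if g C 1 = 1 then (U C).det else 1)
  have hφ : Function.Injective φ := by
    intro C D hCD
    obtain ⟨h1, h2⟩ := Prod.mk.inj hCD
    have h3 := hUR C
    rw [h1] at h3
    have h4 := star_mul_self_symm (hU C)
    have h5 : U D * star (U C) * C.out = D.out * (U D * star (U C)) := by
      have h6 : star (U C) * C.out = R (g D) * star (U C) := by
        calc star (U C) * C.out = star (U C) * (C.out * U C) * star (U C) := by
              rw [mul_assoc, mul_assoc (C.out : Matrix (Fin n) (Fin n) F), h4, mul_one]
          _ = _ := by rw [← h3, ← mul_assoc, hU, one_mul]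
      rw [mul_assoc, h6, ← mul_assoc, hUR, mul_assoc]
    have h6 : star (U D * star (U C)) * (U D * star (U C)) = 1 := by
      rw [star_mul, star_star, mul_assoc, ← mul_assoc (star (U D)), hU, one_mul, h4]
    have h7 : (U D * star (U C)).det = (U D).det * star (U C).det := by
      rw [Matrix.det_mul, Matrix.star_eq_conjTranspose, Matrix.det_conjTranspose]
    suffices h : IsConj C.out D.out by
      exact (Quotient.out_eq C).symm.trans
        ((ConjClasses.mk_eq_mk_iff_isConj.mpr h).trans (Quotient.out_eq D))
    rw [isConj_iff]
    by_cases h8 : g D 1 = 1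
    · rw [h1, if_pos h8, if_pos h8] at h2
      refine ⟨_, h6, ?_, h5⟩
      rw [h7, ← h2, hdetU]
    · have hz : (star (U D).det * (U C).det) * star (star (U D).det * (U C).det) = 1 := by
        rw [star_mul', star_star]
        linear_combination (U C).det * star (U C).det * hdetU D + hdetU C
      obtain ⟨V, hV, hV', hVz⟩ := (hg C).exists_unitary_commute_det hc (star_mul_self _)
        (by rwa [h1]) hz
      refine ⟨U D * star (U C) * V, ?_, ?_, ?_⟩
      · rw [star_mul, mul_assoc, ← mul_assoc (star (U D * star (U C))), h6, one_mul, hV]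
      · rw [Matrix.det_mul, h7, hVz]
        linear_combination (U C).det * star (U C).det * hdetU D + hdetU C
      · rw [mul_assoc, ← hV'.eq, ← mul_assoc, h5, mul_assoc]
  have := Fintype.ofFinite (ConjClasses (SU n F))
  rw [Nat.card_eq_fintype_card, ← Finset.card_univ]
  calc Finset.univ.card
      ≤ (S ×ˢ {1} ∪ T ×ˢ Finset.univ.filter fun x : F => x * star x = 1).card := by
        refine Finset.card_le_card_of_injOn φ (fun C _ => ?_) hφ.injOn
        by_cases h : g C 1 = 1
        · refine Finset.mem_coe.mpr (Finset.mem_union_right _ (Finset.mem_product.mpr ?_))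
          simpa [φ, h, hdetU] using hT _ _ (hg C) h
        · refine Finset.mem_coe.mpr (Finset.mem_union_left _ (Finset.mem_product.mpr ?_))
          simpa [φ, h] using hS _ _ (hg C) h
    _ ≤ S.card + T.card * (Finset.univ.filter fun x : F => x * star x = 1).card := by
        refine (Finset.card_union_le _ _).trans ?_
        rw [Finset.card_product, Finset.card_product, Finset.card_singleton, mul_one]
    _ ≤ _ := by
        gcongr
        convert card_mul_star_eq_one_le hstar

end SU

end ConjClassesSU

section PrimaryTypeCount

open Polynomial

open Classical in
/-- The families of self-dual polynomials supported on `2, …, k + 1`, of total weighted degree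
`m`. -/
noncomputable def primaryTypes (F : Type*) [Field F] [Fintype F] [StarRing F] :
    ℕ → ℕ → Finset (ℕ → F[X])
  | 0, m => if m = 0 then {fun _ => 1} else ∅
  | k + 1, m => (Finset.range (m / (k + 2) + 1)).biUnion fun j =>
      Finset.image₂ (fun f g => Function.update g (k + 2) f) (selfDualPolynomialsOfDegree F j)
        (primaryTypes F k (m - j * (k + 2)))

variable {F : Type*} [Field F] [Fintype F] [StarRing F]

omit [Fintype F] in
theorem Polynomial.isConjSelfDual_one : (1 : F[X]).IsConjSelfDual :=
  ⟨monic_one, by simp, conjDual_one⟩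

theorem mem_primaryTypes (k : ℕ) : ∀ (m : ℕ) (g : ℕ → F[X]), (∀ i, (g i).IsConjSelfDual) →
    (∀ i, ¬ (2 ≤ i ∧ i ≤ k + 1) → g i = 1) →
    ∑ i ∈ Finset.range (k + 2), i * (g i).natDegree = m → g ∈ primaryTypes F k m := by
  classical
  induction k with
  | zero =>
    intro m g _ h2 h3
    have h4 : g = fun _ => 1 := funext fun i => h2 i (by omega)
    rw [h4] at h3
    rw [primaryTypes, if_pos (by simpa using h3.symm), h4, Finset.mem_singleton]
  | succ k ih =>
    intro m g h1 h2 h3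
    have h4 : g = Function.update (Function.update g (k + 2) 1) (k + 2) (g (k + 2)) := by simp
    have h5 : ∑ i ∈ Finset.range (k + 2), i * (Function.update g (k + 2) 1 i).natDegree =
        ∑ i ∈ Finset.range (k + 2), i * (g i).natDegree := by
      refine Finset.sum_congr rfl fun i hi => ?_
      rw [Function.update_of_ne (Finset.mem_range.mp hi).ne]
    rw [Finset.sum_range_succ, mul_comm] at h3
    rw [primaryTypes, Finset.mem_biUnion]
    refine ⟨(g (k + 2)).natDegree, ?_, ?_⟩
    · rw [Finset.mem_range, Nat.lt_succ_iff, Nat.le_div_iff_mul_le (by omega)]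
      omega
    · rw [Finset.mem_image₂]
      refine ⟨_, mem_selfDualPolynomialsOfDegree (h1 _), _,
        ih _ _ (fun i => ?_) (fun i hi => ?_) ?_, h4.symm⟩
      · rcases eq_or_ne i (k + 2) with rfl | hi
        · rw [Function.update_self]
          exact isConjSelfDual_one
        · rw [Function.update_of_ne hi]
          exact h1 i
      · rcases eq_or_ne i (k + 2) with rfl | hi'
        · rw [Function.update_self]
        · rw [Function.update_of_ne hi']
          exact h2 i (by omega)
      · rw [h5]
        omega

/-- The value of `card_primaryTypes_le` for `q = 2`. -/
def primaryTypeCount : ℕ → ℕ → ℕ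
  | 0, m => if m = 0 then 1 else 0
  | k + 1, m => ∑ j ∈ Finset.range (m / (k + 2) + 1),
      (if j = 0 then 1 else 3 * 2 ^ (j - 1)) * primaryTypeCount k (m - j * (k + 2))

theorem card_primaryTypes_le {q : ℕ} (hq : 1 < q) (hF : Fintype.card F = q ^ 2)
    (hstar : ∀ x : F, star x = x ^ q) (k : ℕ) : ∀ m : ℕ, ((primaryTypes F k m).card : ℝ) ≤
      (q / 2 : ℝ) ^ (if m = 2 then 1 else m - 2) * primaryTypeCount k m := by
  have hq' : (2 : ℝ) ≤ q := by exact_mod_cast hq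
  have hx : (1 : ℝ) ≤ q / 2 := by linarith
  classical
  induction k with
  | zero =>
    intro m
    rw [primaryTypes, primaryTypeCount]
    split_ifs <;> simp_all
  | succ k ih =>
    intro m
    rw [primaryTypes, primaryTypeCount, Nat.cast_sum, Finset.mul_sum]
    refine (Nat.cast_le.mpr Finset.card_biUnion_le).trans ?_
    rw [Nat.cast_sum]
    refine Finset.sum_le_sum fun j hj => ?_
    rw [Finset.mem_range, Nat.lt_succ_iff, Nat.le_div_iff_mul_le (by omega)] at hj
    have h1 : ((selfDualPolynomialsOfDegree F j).card : ℝ) ≤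
        (q / 2 : ℝ) ^ j * (if j = 0 then 1 else 3 * 2 ^ (j - 1) : ℕ) := by
      rcases j with _ | j
      · simp [selfDualPolynomialsOfDegree]
      · refine (Nat.cast_le.mpr (card_selfDualPolynomialsOfDegree_le hq hF hstar j)).trans ?_
        rw [if_neg (by omega), Nat.add_sub_cancel, div_pow, pow_succ, pow_succ]
        push_cast
        have : (0 : ℝ) < 2 ^ j := by positivity
        have h2 : (q : ℝ) ^ j * q / (2 ^ j * 2) * (3 * 2 ^ j) = q ^ j * (3 / 2 * q) := by
          field_simp
        rw [h2, mul_comm]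
        gcongr
        linarith
    have h2 : j + (if m - j * (k + 2) = 2 then 1 else m - j * (k + 2) - 2) ≤
        (if m = 2 then 1 else m - 2) := by
      have : j * 2 ≤ j * (k + 2) := Nat.mul_le_mul_left _ (by omega)
      generalize j * (k + 2) = x at *
      split_ifs <;> omega
    calc _ ≤ (((selfDualPolynomialsOfDegree F j).card *
          (primaryTypes F k (m - j * (k + 2))).card : ℕ) : ℝ) :=
          Nat.cast_le.mpr (Finset.card_image₂_le _ _ _)
      _ ≤ ((q / 2 : ℝ) ^ j * (if j = 0 then 1 else 3 * 2 ^ (j - 1) : ℕ)) *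
          ((q / 2 : ℝ) ^ (if m - j * (k + 2) = 2 then 1 else m - j * (k + 2) - 2) *
            primaryTypeCount k (m - j * (k + 2))) := by
          rw [Nat.cast_mul]
          exact mul_le_mul h1 (ih _) (Nat.cast_nonneg _) (by positivity)
      _ = (q / 2 : ℝ) ^ (j + (if m - j * (k + 2) = 2 then 1 else m - j * (k + 2) - 2)) *
          ((if j = 0 then 1 else 3 * 2 ^ (j - 1) : ℕ) *
            primaryTypeCount k (m - j * (k + 2)) :) := by
          rw [pow_add, Nat.cast_mul]
          ring
      _ ≤ _ := by
          gcongr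

namespace SU

theorem mem_primaryTypes_of_apply_one {d : ℕ} (A : SU (d + 1) F) {g : ℕ → F[X]}
    (h : Matrix.HasPrimaryType (A : Matrix (Fin (d + 1)) (Fin (d + 1)) F) g) :
    Function.update g 1 1 ∈ primaryTypes F d (d + 1 - (g 1).natDegree) ∧
      (g 1).natDegree ≤ d + 1 ∧
      (-1) ^ (d + 1) * ((g 1).coeff 0 *
        ∏ k ∈ Finset.range (d + 2), (Function.update g 1 1 k).coeff 0 ^ k) = 1 := by
  obtain ⟨h1, h2, h3⟩ := h.exists_weights
  rw [Fintype.card_fin] at h1 h2 h3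
  have hmem : 1 ∈ Finset.range (d + 2) := Finset.mem_range.mpr (by omega)
  rw [← Finset.add_sum_erase _ _ hmem, one_mul] at h2
  rw [det_eq_one, ← Finset.mul_prod_erase _ _ hmem, pow_one] at h3
  refine ⟨mem_primaryTypes d _ _ (fun i => ?_) (fun i hi => ?_) ?_, by omega, ?_⟩
  · rcases eq_or_ne i 1 with rfl | hi
    · rw [Function.update_self]
      exact isConjSelfDual_one
    · rw [Function.update_of_ne hi]
      exact h.isConjSelfDual (star_mul_self A) i
  · rcases eq_or_ne i 1 with rfl | hi'
    · rw [Function.update_self]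
    · rw [Function.update_of_ne hi']
      rcases Nat.eq_zero_or_pos i with rfl | h0
      · exact h.apply_zero
      · exact h1 i (by omega)
  · rw [← Finset.add_sum_erase _ _ hmem, Function.update_self, natDegree_one, mul_zero, zero_add,
      ← h2, Nat.add_sub_cancel_left]
    refine Finset.sum_congr rfl fun i hi => ?_
    rw [Function.update_of_ne (Finset.ne_of_mem_erase hi)]
  · rw [← Finset.mul_prod_erase _ _ hmem, Function.update_self, coeff_one_zero, one_pow, one_mul]
    refine Eq.trans ?_ h3.symm
    congr 2
    refine Finset.prod_congr rfl fun i hi => ?_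
    rw [Function.update_of_ne (Finset.ne_of_mem_erase hi)]

theorem card_conjClasses_le_sum {q : ℕ} (hq : 1 < q) (hF : Fintype.card F = q ^ 2)
    (hstar : ∀ x : F, star x = x ^ q) (d : ℕ) (T : Finset (ℕ → F[X]))
    (hT : ∀ (A : SU (d + 1) F) (g : ℕ → F[X]),
      Matrix.HasPrimaryType (A : Matrix (Fin (d + 1)) (Fin (d + 1)) F) g → g 1 = 1 → g ∈ T) :
    Nat.card (ConjClasses (SU (d + 1) F)) ≤
      ∑ m ∈ Finset.range (d + 1), (primaryTypes F d m).card * q ^ (d - m) +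
        T.card * (q + 1) := by
  classical
  let c : (ℕ → F[X]) → F := fun g =>
    ((-1) ^ (d + 1) * ∏ k ∈ Finset.range (d + 2), (g k).coeff 0 ^ k)⁻¹
  refine (card_conjClasses_le hq hF hstar ((Finset.range (d + 1)).biUnion fun m =>
    (primaryTypes F d m).biUnion fun g =>
      (selfDualPolynomials (d - m) (c g)).image (Function.update g 1)) T ?_ hT).trans ?_
  · intro A g h h1
    obtain ⟨h2, h3, h4⟩ := mem_primaryTypes_of_apply_one A h
    have h5 := h.isConjSelfDual (star_mul_self A) 1
    have h6 : (g 1).natDegree ≠ 0 := fun h0 => h1 (h5.1.natDegree_eq_zero.mp h0)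
    simp only [Finset.mem_biUnion, Finset.mem_image, Finset.mem_range]
    refine ⟨_, by omega, _, h2, g 1, ?_, by simp⟩
    have h7 : c (Function.update g 1 1) = (g 1).coeff 0 :=
      inv_eq_of_mul_eq_one_left (by linear_combination h4)
    rw [h7]
    exact mem_selfDualPolynomials h5 (by omega)
  · gcongr
    refine Finset.card_biUnion_le.trans (Finset.sum_le_sum fun m _ => ?_)
    exact Finset.card_biUnion_le_card_mul _ _ _ fun g _ =>
      Finset.card_image_le.trans (card_selfDualPolynomials_le hq hF hstar _ _)

theorem card_conjClasses_one_le {q : ℕ} (hq : 1 < q) (hF : Fintype.card F = q ^ 2)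
    (hstar : ∀ x : F, star x = x ^ q) : Nat.card (ConjClasses (SU 1 F)) ≤ 1 := by
  refine (card_conjClasses_le_sum hq hF hstar 0 ∅ fun A g h h1 => ?_).trans ?_
  · have h2 := (mem_primaryTypes_of_apply_one A h).1
    rw [h1] at h2
    simp [primaryTypes] at h2
  · simp [primaryTypes]

theorem card_conjClasses_two_le {q : ℕ} (hq : 1 < q) (hF : Fintype.card F = q ^ 2)
    (hstar : ∀ x : F, star x = x ^ q) : Nat.card (ConjClasses (SU 2 F)) ≤ q + 2 * (q + 1) := by
  classical
  refine (card_conjClasses_le_sum hq hF hstar 1 (({1, -1} : Finset F).image fun c =>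
    Function.update (fun _ => 1) 2 (X + C c)) fun A g h h1 => ?_).trans ?_
  · obtain ⟨h2, h3, h4⟩ := h.exists_weights
    rw [det_eq_one] at h4
    simp only [Fintype.card_fin, Finset.sum_range_succ, Finset.prod_range_succ, Finset.range_zero,
      Finset.sum_empty, Finset.prod_empty, h1, h.apply_zero] at h3 h4
    simp at h3 h4
    have h5 := h.isConjSelfDual (star_mul_self A) 2
    have h6 : g 2 = X + C ((g 2).coeff 0) := h5.1.eq_X_add_C h3
    rw [Finset.mem_image]
    refine ⟨(g 2).coeff 0, ?_, ?_⟩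
    · simpa using h4.symm
    · funext i
      rw [← h6]
      rcases eq_or_ne i 2 with rfl | hi
      · simp
      · rw [Function.update_of_ne hi]
        rcases Nat.lt_trichotomy i 1 with hi' | rfl | hi'
        · rw [Nat.lt_one_iff.mp hi', h.apply_zero]
        · exact h1.symm
        · exact (h2 i (by rw [Fintype.card_fin]; omega)).symm
  · rw [Finset.sum_range_succ, Finset.sum_range_one]
    have h1 := card_primaryTypes_le hq hF hstar 1 0
    have h2 := card_primaryTypes_le hq hF hstar 1 1
    simp only [primaryTypeCount] at h1 h2
    norm_num at h1 h2
    have h3 : Finset.card (({1, -1} : Finset F).image fun c =>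
        Function.update (fun _ => (1 : F[X])) 2 (X + C c)) ≤ 2 :=
      Finset.card_image_le.trans Finset.card_le_two
    rw [h2, Finset.card_empty, zero_mul, add_zero, Nat.sub_zero, pow_one]
    refine add_le_add ?_ (Nat.mul_le_mul_right _ h3)
    simpa using Nat.mul_le_mul_right q h1

theorem card_conjClasses_le_mul {q : ℕ} (hq : 1 < q) (hF : Fintype.card F = q ^ 2)
    (hstar : ∀ x : F, star x = x ^ q) {d : ℕ} (hd : 2 ≤ d) :
    (Nat.card (ConjClasses (SU (d + 1) F)) : ℝ) ≤
      (∑ m ∈ Finset.range (d + 1), (primaryTypeCount d m / 2 ^ m : ℝ) +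
        6 * (primaryTypeCount d (d + 1) / 2 ^ (d + 1))) * q ^ d := by
  have hq' : (2 : ℝ) ≤ q := by exact_mod_cast hq
  have hx : (1 : ℝ) ≤ q / 2 := by linarith
  have h1 := card_conjClasses_le_sum hq hF hstar d (primaryTypes F d (d + 1)) fun A g h h1 => by
    have h2 := (mem_primaryTypes_of_apply_one A h).1
    rwa [h1, natDegree_one, Nat.sub_zero, ← h1, Function.update_eq_self] at h2
  refine (Nat.cast_le.mpr h1).trans ?_
  push_cast
  rw [add_mul, Finset.sum_mul]
  refine add_le_add (Finset.sum_le_sum fun m hm => ?_) ?_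
  · have h2 : m ≤ d := by simpa [Nat.lt_succ_iff] using hm
    calc ((primaryTypes F d m).card : ℝ) * q ^ (d - m)
        ≤ ((q / 2 : ℝ) ^ m * primaryTypeCount d m) * q ^ (d - m) := by
          gcongr
          refine (card_primaryTypes_le hq hF hstar d m).trans ?_
          refine mul_le_mul_of_nonneg_right (pow_le_pow_right₀ hx ?_) (Nat.cast_nonneg _)
          split_ifs <;> omega
      _ = primaryTypeCount d m / 2 ^ m * (q ^ m * q ^ (d - m)) := by
          rw [div_pow]
          ring
      _ = _ := by rw [← pow_add, Nat.add_sub_cancel' h2]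
  · obtain ⟨e, rfl⟩ : ∃ e, d = e + 1 := ⟨d - 1, by omega⟩
    have h2 := card_primaryTypes_le hq hF hstar (e + 1) (e + 1 + 1)
    rw [if_neg (by omega), show e + 1 + 1 - 2 = e by omega] at h2
    calc ((primaryTypes F (e + 1) (e + 1 + 1)).card : ℝ) * (q + 1)
        ≤ ((q / 2 : ℝ) ^ e * primaryTypeCount (e + 1) (e + 1 + 1)) * (3 / 2 * q) := by
          gcongr
          linarith
      _ = _ := by
          rw [div_pow, pow_succ, pow_succ, pow_succ]
          field_simp
          ring

end SU

end PrimaryTypeCount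

section PrimaryTypeCountBound

theorem primaryTypeCount_eq_of_le {k l m : ℕ} (h : m ≤ k + 1) (hkl : k ≤ l) :
    primaryTypeCount l m = primaryTypeCount k m := by
  induction l, hkl using Nat.le_induction with
  | base => rfl
  | succ l hl ih =>
    rw [primaryTypeCount, Nat.div_eq_of_lt (by omega)]
    simp [ih]

theorem sum_mul_pow_le {y : ℝ} (hy : 0 ≤ y) (hy' : y < 1) (N : ℕ) :
    ∑ j ∈ Finset.range N, ((if j = 0 then 1 else 3 * 2 ^ (j - 1) : ℕ) : ℝ) * (y / 2) ^ j ≤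
      1 + 3 / 2 * (y / (1 - y)) := by
  have h1 : 1 - y ≠ 0 := (sub_pos.mpr hy').ne'
  have h2 : ∀ N : ℕ,
      ∑ j ∈ Finset.range (N + 1), ((if j = 0 then 1 else 3 * 2 ^ (j - 1) : ℕ) : ℝ) * (y / 2) ^ j =
        1 + 3 / 2 * ((y - y ^ (N + 1)) / (1 - y)) := by
    intro N
    induction N with
    | zero => simp
    | succ N ih =>
      rw [Finset.sum_range_succ, ih, if_neg (by omega), Nat.add_sub_cancel, div_pow]
      push_cast
      field_simp
      ring
  calc _ ≤ ∑ j ∈ Finset.range (N + 1),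
        ((if j = 0 then 1 else 3 * 2 ^ (j - 1) : ℕ) : ℝ) * (y / 2) ^ j := by
        refine Finset.sum_le_sum_of_subset_of_nonneg (Finset.range_mono N.le_succ) ?_
        intro j _ _
        positivity
    _ ≤ _ := by
        rw [h2]
        have := (sub_pos.mpr hy').le
        gcongr
        exact sub_le_self _ (by positivity)

theorem sum_primaryTypeCount_le (k : ℕ) : ∀ N : ℕ,
    ∑ m ∈ Finset.range N, (primaryTypeCount k m / 2 ^ m : ℝ) ≤
      ∏ i ∈ Finset.range k, (1 + 3 / 2 * ((1 / 2) ^ (i + 1) / (1 - (1 / 2) ^ (i + 1))) : ℝ) := by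
  induction k with
  | zero =>
    intro N
    rw [Finset.prod_range_zero]
    calc _ ≤ ∑ m ∈ Finset.range (N + 1), (primaryTypeCount 0 m / 2 ^ m : ℝ) := by
          refine Finset.sum_le_sum_of_subset_of_nonneg (Finset.range_mono N.le_succ) ?_
          intro j _ _
          positivity
      _ = 1 := by
          rw [Finset.sum_range_succ']
          simp [primaryTypeCount]
  | succ k ih =>
    intro N
    set s : ℕ → ℕ := fun j => if j = 0 then 1 else 3 * 2 ^ (j - 1) with hs
    set Q := ∏ i ∈ Finset.range k,
      (1 + 3 / 2 * ((1 / 2) ^ (i + 1) / (1 - (1 / 2) ^ (i + 1))) : ℝ) with hQ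
    have h1 : ∀ m ∈ Finset.range N, (primaryTypeCount (k + 1) m / 2 ^ m : ℝ) =
        ∑ j ∈ Finset.range N, if j * (k + 2) ≤ m then
          s j * ((1 / 2) ^ (k + 1) / 2) ^ j *
            (primaryTypeCount k (m - j * (k + 2)) / 2 ^ (m - j * (k + 2)) : ℝ) else 0 := by
      intro m hm
      rw [Finset.mem_range] at hm
      rw [← Finset.sum_filter, primaryTypeCount, Nat.cast_sum, Finset.sum_div]
      have h2 : Finset.range (m / (k + 2) + 1) =
          (Finset.range N).filter fun j => j * (k + 2) ≤ m := by
        ext j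
        rw [Finset.mem_range, Nat.lt_succ_iff, Nat.le_div_iff_mul_le (by omega), Finset.mem_filter,
          Finset.mem_range]
        refine ⟨fun h => ⟨?_, h⟩, fun h => h.2⟩
        nlinarith
      rw [h2]
      refine Finset.sum_congr rfl fun j hj => ?_
      have h3 := (Finset.mem_filter.mp hj).2
      have h4 : (2 : ℝ) ^ m = 2 ^ (m - j * (k + 2)) * 2 ^ (j * (k + 2)) := by
        rw [← pow_add, Nat.sub_add_cancel h3]
      have h5 : ((1 / 2 : ℝ) ^ (k + 1) / 2) ^ j = 1 / 2 ^ (j * (k + 2)) := by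
        rw [mul_comm j, pow_mul, ← one_div_pow, pow_succ (2 : ℝ) (k + 1)]
        congr 1
        rw [one_div_pow]
        field_simp
      rw [h4, h5, Nat.cast_mul]
      field_simp
      rw [mul_comm]
    have h6 : ∀ x, ∑ m ∈ Finset.range N, (if x ≤ m then
        (primaryTypeCount k (m - x) / 2 ^ (m - x) : ℝ) else 0) ≤ Q := by
      intro x
      rw [← Finset.sum_filter]
      have h7 : (Finset.range N).filter (x ≤ ·) = Finset.Ico x N := by
        ext m
        simp [and_comm]
      rw [h7, Finset.sum_Ico_eq_sum_range]
      simp only [Nat.add_sub_cancel_left]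
      exact ih _
    have hQ0 : 0 ≤ Q := (Finset.sum_nonneg fun _ _ => by positivity).trans (ih 0)
    rw [Finset.sum_congr rfl h1, Finset.sum_comm, Finset.prod_range_succ]
    calc _ = ∑ j ∈ Finset.range N, s j * ((1 / 2) ^ (k + 1) / 2) ^ j *
          ∑ m ∈ Finset.range N, (if j * (k + 2) ≤ m then
            (primaryTypeCount k (m - j * (k + 2)) / 2 ^ (m - j * (k + 2)) : ℝ) else 0) := by
          refine Finset.sum_congr rfl fun j _ => ?_
          rw [Finset.mul_sum]
          exact Finset.sum_congr rfl fun m _ => by rw [mul_ite, mul_zero]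
      _ ≤ ∑ j ∈ Finset.range N, s j * ((1 / 2) ^ (k + 1) / 2) ^ j * Q := by
          gcongr
          exact h6 _
      _ ≤ _ := by
          rw [← Finset.sum_mul, mul_comm]
          refine mul_le_mul_of_nonneg_left (sum_mul_pow_le (by positivity) ?_ N) hQ0
          exact pow_lt_one₀ (by norm_num) (by norm_num) k.succ_ne_zero

theorem prod_one_add_le {k : ℕ} (hk : 3 ≤ k) :
    ∏ i ∈ Finset.range k, (1 + 3 / 2 * ((1 / 2) ^ (i + 1) / (1 - (1 / 2) ^ (i + 1))) : ℝ) ≤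
      5.61 * (1 - 3 * (1 / 2) ^ (k + 1)) := by
  induction k, hk using Nat.le_induction with
  | base =>
    simp only [Finset.prod_range_succ, Finset.prod_range_zero]
    norm_num
  | succ k hk ih =>
    rw [Finset.prod_range_succ, pow_succ _ (k + 1)]
    have h1 : (1 / 2 : ℝ) ^ (k + 1) ≤ 1 / 2 :=
      pow_le_of_le_one (by norm_num) (by norm_num) k.succ_ne_zero
    have h2 : (0 : ℝ) < (1 / 2) ^ (k + 1) := by positivity
    generalize (1 / 2 : ℝ) ^ (k + 1) = y at *
    have h3 : 0 < 1 - y := by linarith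
    calc _ ≤ 5.61 * (1 - 3 * y) * (1 + 3 / 2 * (y / (1 - y))) := by gcongr
      _ ≤ _ := by
        have h4 : 1 + 3 / 2 * (y / (1 - y)) = (1 + y / 2) / (1 - y) := by
          field_simp
          ring
        rw [h4, ← mul_div_assoc, div_le_iff₀ h3]
        nlinarith

theorem primaryTypeCount_bound {d : ℕ} (hd : 2 ≤ d) :
    ∑ m ∈ Finset.range (d + 1), (primaryTypeCount d m / 2 ^ m : ℝ) +
      6 * (primaryTypeCount d (d + 1) / 2 ^ (d + 1)) ≤ 8.26 := by
  rcases Nat.lt_or_ge d 14 with h | h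
  · have h1 : ∀ d ∈ Finset.Ico 2 14, 100 * (∑ m ∈ Finset.range (d + 1),
        primaryTypeCount d m * 2 ^ (d + 1 - m) + 6 * primaryTypeCount d (d + 1)) ≤
          826 * 2 ^ (d + 1) := by
      decide +kernel
    have h2 := h1 d (Finset.mem_Ico.mpr ⟨hd, h⟩)
    have h3 : (100 * (∑ m ∈ Finset.range (d + 1),
        primaryTypeCount d m * 2 ^ (d + 1 - m) + 6 * primaryTypeCount d (d + 1)) : ℝ) ≤
          826 * 2 ^ (d + 1) := by exact_mod_cast h2
    have h4 : ∑ m ∈ Finset.range (d + 1), (primaryTypeCount d m * 2 ^ (d + 1 - m) : ℝ) =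
        (∑ m ∈ Finset.range (d + 1), (primaryTypeCount d m / 2 ^ m : ℝ)) * 2 ^ (d + 1) := by
      rw [Finset.sum_mul]
      refine Finset.sum_congr rfl fun m hm => ?_
      rw [pow_sub₀ _ two_ne_zero (Finset.mem_range.mp hm).le]
      field_simp
    push_cast at h3
    rw [h4] at h3
    have h5 : (0 : ℝ) < 2 ^ (d + 1) := by positivity
    rw [← mul_le_mul_iff_left₀ h5, add_mul, mul_assoc 6, div_mul_cancel₀ _ h5.ne']
    linarith
  · have h1 := (sum_primaryTypeCount_le d (d + 2)).trans (prod_one_add_le (by omega))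
    have h2 : (0 : ℝ) ≤ (1 / 2) ^ (d + 1) := by positivity
    rw [Finset.sum_range_succ] at h1
    have h3 : (5.18 : ℝ) ≤ ∑ m ∈ Finset.range (d + 1), (primaryTypeCount d m / 2 ^ m : ℝ) := by
      calc (5.18 : ℝ) ≤ ∑ m ∈ Finset.range 15, (primaryTypeCount 13 m / 2 ^ m : ℝ) := by
            have h4 : 518 * 2 ^ 14 ≤
                100 * ∑ m ∈ Finset.range 15, primaryTypeCount 13 m * 2 ^ (14 - m) := by
              decide +kernel
            have h5 : (518 * 2 ^ 14 : ℝ) ≤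
                100 * ∑ m ∈ Finset.range 15, primaryTypeCount 13 m * 2 ^ (14 - m) := by
              exact_mod_cast h4
            have h6 : ∑ m ∈ Finset.range 15, (primaryTypeCount 13 m * 2 ^ (14 - m) : ℝ) =
                (∑ m ∈ Finset.range 15, (primaryTypeCount 13 m / 2 ^ m : ℝ)) * 2 ^ 14 := by
              rw [Finset.sum_mul]
              refine Finset.sum_congr rfl fun m hm => ?_
              rw [pow_sub₀ _ two_ne_zero (Nat.lt_succ_iff.mp (Finset.mem_range.mp hm))]
              field_simp
            push_cast at h5
            rw [h6] at h5
            linarith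
        _ = ∑ m ∈ Finset.range 15, (primaryTypeCount d m / 2 ^ m : ℝ) := by
            refine Finset.sum_congr rfl fun m hm => ?_
            rw [primaryTypeCount_eq_of_le (Nat.lt_succ_iff.mp (Finset.mem_range.mp hm))
              (show 13 ≤ d by omega)]
        _ ≤ _ := by
            refine Finset.sum_le_sum_of_subset_of_nonneg (Finset.range_mono (by omega)) ?_
            intro j _ _
            positivity
    linarith

end PrimaryTypeCountBound

/-- Proposition 3.12(1): `q^{n-1} ≤ k(SU(n,q)) ≤ 8.26 q^{n-1}`.  Here the unitary group
is taken with respect to the star operation `x ↦ x^q` on a field with `q²` elements. -/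
theorem stmt_11 (q : ℕ) (hq : IsPrimePow q)
    (F : Type*) [Field F] [Fintype F] [StarRing F]
    (hF : Fintype.card F = q ^ 2) (hstar : ∀ x : F, star x = x ^ q)
    (n : ℕ) (hn : 1 ≤ n) :
    ((q : ℝ) ^ (n - 1) ≤ (Nat.card (ConjClasses (SU n F)) : ℝ)) ∧
    (Nat.card (ConjClasses (SU n F)) : ℝ) ≤ 8.26 * (q : ℝ) ^ (n - 1) := by
  have hq1 := hq.one_lt
  have hq2 : (2 : ℝ) ≤ q := by exact_mod_cast hq1
  obtain ⟨d, rfl⟩ : ∃ d, n = d + 1 := ⟨n - 1, by omega⟩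
  rw [Nat.add_sub_cancel]
  refine ⟨by exact_mod_cast SU.pow_le_card_conjClasses hq1 hF hstar d, ?_⟩
  match d with
  | 0 =>
    have : (Nat.card (ConjClasses (SU 1 F)) : ℝ) ≤ 1 := by
      exact_mod_cast SU.card_conjClasses_one_le hq1 hF hstar
    rw [zero_add, pow_zero]
    linarith
  | 1 =>
    have : (Nat.card (ConjClasses (SU 2 F)) : ℝ) ≤ q + 2 * (q + 1) := by
      exact_mod_cast SU.card_conjClasses_two_le hq1 hF hstar
    rw [one_add_one_eq_two, pow_one]
    linarith
  | d + 2 =>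
    refine (SU.card_conjClasses_le_mul hq1 hF hstar (by omega)).trans ?_
    gcongr
    exact primaryTypeCount_bound (by omega)
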